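/- For every integer n ≥ 2, the bipartite Ramsey number BR(C_8, C_{2n}) equals 8 if n = 4, and equals n+3 otherwise. -/

import Mathlib

open SimpleGraph Sum

/-- The complete bipartite graph `K_{t,t}` with both parts a copy of `Fin t`. -/
abbrev Kbb (t : ℕ) : SimpleGraph (Fin t ⊕ Fin t) := completeBipartiteGraph (Fin t) (Fin t)

/-- `G` contains a cycle of length `m`. -/
def HasCycleLen {V : Type*} (G : SimpleGraph V) (m : ℕ) : Prop :=
  ∃ (v : V) (w : G.Walk v v), w.IsCycle ∧ w.length = m

/-- Every subgraph `G` of `K_{b,b}` contains a cycle of length `m`, or its bipartite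
complement in `K_{b,b}` contains a cycle of length `n`. -/
def BRprop (m n b : ℕ) : Prop :=
  ∀ G : SimpleGraph (Fin b ⊕ Fin b), G ≤ Kbb b →
    HasCycleLen G m ∨ HasCycleLen (Kbb b \ G) n

/-- `f` restricted to indices below `N` has no cycle of length `8`. -/
def RedFree (N : ℕ) : Set (ℕ → ℕ → Prop) :=
  {f | ∀ a c : ℕ → ℕ, Set.InjOn a (Set.Iio 4) → Set.InjOn c (Set.Iio 4) →
    Set.MapsTo a (Set.Iio 4) (Set.Iio N) → Set.MapsTo c (Set.Iio 4) (Set.Iio N) → c 4 = c 0 →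
    ¬ ∀ i < 4, f (a i) (c i) ∧ f (a i) (c (i + 1))}

/-- The complement of `f` restricted to indices below `N` has no cycle of length `2 * K`; if `fix`
is set, only cycles through the pair `(0, 0)` are forbidden, and that pair need not be an edge. -/
def BlueFree (N K : ℕ) (fix : Bool) : Set (ℕ → ℕ → Prop) :=
  {f | ∀ a c : ℕ → ℕ, Set.InjOn a (Set.Iio K) → Set.InjOn c (Set.Iio K) →
    Set.MapsTo a (Set.Iio K) (Set.Iio N) → Set.MapsTo c (Set.Iio K) (Set.Iio N) → c K = c 0 →
    (fix = true → a 0 = 0 ∧ c 0 = 0) →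
    ¬ ∀ i < K, ((fix = true → i ≠ 0) → ¬ f (a i) (c i)) ∧ ¬ f (a i) (c (i + 1))}

/-- A partial colouring: two bit masks of cells of an `8 × 8` array, the red and the blue one. The
cell `(i, j)` is the bit `8 * i + j`. -/
abbrev Mask := ℕ × ℕ

/-- The colouring `f` extends the partial colouring `m`. -/
def Extends (f : ℕ → ℕ → Prop) (m : Mask) : Prop :=
  ∀ i < 8, ∀ j < 8, (m.1.testBit (8 * i + j) = true → f i j) ∧
    (m.2.testBit (8 * i + j) = true → ¬ f i j)

/-- No colouring in `F` extends `m`. -/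
def Refuted (F : Set (ℕ → ℕ → Prop)) (m : Mask) : Prop := ∀ f ∈ F, ¬ Extends f m

/-- The `i`-th octal digit of `p`. -/
def octDigit (p i : ℕ) : ℕ := (p >>> (3 * i)) &&& 7

/-- The bit mask of the set of the `n` lowest octal digits of `p`. -/
def digitSet (p : ℕ) : ℕ → ℕ
  | 0 => 0
  | n + 1 => digitSet p n ||| 1 <<< octDigit p n

/-- Permute the columns of an array according to the octal digits of `t`. -/
def colImage (t m : ℕ) : ℕ → ℕ
  | 0 => 0
  | j + 1 => colImage t m j ||| ((m >>> j) &&& 72340172838076673) <<< octDigit t j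

/-- Permute the rows of an array according to the octal digits of `s`. -/
def rowImage (s m : ℕ) : ℕ → ℕ
  | 0 => 0
  | i + 1 => rowImage s m i ||| ((m >>> (8 * i)) &&& 255) <<< (8 * octDigit s i)

/-- Permute rows and columns of an array. -/
def image (s t m : ℕ) : ℕ := rowImage s (colImage t m 8) 8

theorem octDigit_lt (p i : ℕ) : octDigit p i < 8 :=
  lt_of_le_of_lt Nat.and_le_right (by norm_num)

theorem testBit_digitSet (p n d : ℕ) :
    (digitSet p n).testBit d = true ↔ ∃ i < n, octDigit p i = d := by
  induction n with
  | zero => simp [digitSet]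
  | succ n ih =>
    rw [digitSet, Nat.testBit_or, Bool.or_eq_true, ih, Nat.one_shiftLeft, Nat.testBit_two_pow]
    simp only [decide_eq_true_eq, Nat.lt_succ_iff_lt_or_eq]
    grind

theorem octDigit_bijOn {p N : ℕ} (h : digitSet p N = 2 ^ N - 1) :
    Set.InjOn (octDigit p) (Set.Iio N) ∧ Set.MapsTo (octDigit p) (Set.Iio N) (Set.Iio N) := by
  have key (d : ℕ) : (∃ i < N, octDigit p i = d) ↔ d < N := by
    rw [← testBit_digitSet, h, Nat.testBit_two_pow_sub_one, decide_eq_true_eq]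
  have hmaps : Set.MapsTo (octDigit p) (Set.Iio N) (Set.Iio N) := fun i hi => (key _).1 ⟨i, hi, rfl⟩
  refine ⟨?_, hmaps⟩
  have hs : Set.SurjOn (octDigit p) (Finset.range N) (Finset.range N) := by
    intro d hd
    obtain ⟨i, hi, e⟩ := (key d).2 (by simpa using hd)
    exact ⟨i, by simpa using hi, e⟩
  have := Finset.injOn_of_surjOn_of_card_le (octDigit p) (s := Finset.range N)
    (t := Finset.range N) (fun i hi => by simpa using hmaps (by simpa using hi)) hs le_rfl
  simpa using this

theorem testBit_colImage {t m i j : ℕ} (n : ℕ) (hi : i < 8) (hj : j < n)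
    (h : m.testBit (8 * i + j) = true) :
    (colImage t m n).testBit (8 * i + octDigit t j) = true := by
  induction n with
  | zero => omega
  | succ n ih =>
    rw [colImage, Nat.testBit_or, Bool.or_eq_true]
    rcases Nat.lt_succ_iff_lt_or_eq.1 hj with hj | rfl
    · exact Or.inl (ih hj)
    · right
      have hM : ∀ i < 8, Nat.testBit 72340172838076673 (8 * i) = true := by decide
      simp [Nat.testBit_shiftLeft, Nat.add_comm j, h, hM i hi]

theorem testBit_rowImage {s m i j : ℕ} (n : ℕ) (hi : i < n) (hj : j < 8)
    (h : m.testBit (8 * i + j) = true) :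
    (rowImage s m n).testBit (8 * octDigit s i + j) = true := by
  induction n with
  | zero => omega
  | succ n ih =>
    rw [rowImage, Nat.testBit_or, Bool.or_eq_true]
    rcases Nat.lt_succ_iff_lt_or_eq.1 hi with hi | rfl
    · exact Or.inl (ih hi)
    · right
      have hM : ∀ j < 8, Nat.testBit 255 j = true := by decide
      simp [Nat.testBit_shiftLeft, h, hM j hj]

theorem testBit_image {s t m i j : ℕ} (hi : i < 8) (hj : j < 8)
    (h : m.testBit (8 * i + j) = true) :
    (image s t m).testBit (8 * octDigit s i + octDigit t j) = true :=
  testBit_rowImage 8 hi (octDigit_lt t j) (testBit_colImage 8 hi hj h)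

theorem Refuted.mono {F F' : Set (ℕ → ℕ → Prop)} {m : Mask} (h : Refuted F m) (hF : F' ⊆ F) :
    Refuted F' m := fun f hf => h f (hF hf)

theorem Refuted.image {F : Set (ℕ → ℕ → Prop)} {m : Mask} {s t : ℕ} (h : Refuted F m)
    (hF : ∀ f ∈ F, (fun i j => f (octDigit s i) (octDigit t j)) ∈ F) :
    Refuted F (image s t m.1, image s t m.2) := fun f hf hE =>
  h _ (hF f hf) fun i hi j hj =>
    ⟨fun hm => (hE _ (octDigit_lt s i) _ (octDigit_lt t j)).1 (testBit_image hi hj hm),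
      fun hm => (hE _ (octDigit_lt s i) _ (octDigit_lt t j)).2 (testBit_image hi hj hm)⟩

/-- Clear the bits of `V` in `x`. -/
def clearBits (x V : ℕ) : ℕ := x ^^^ (x &&& V)

/-- The resolvent of `m` and `m'` on a cell that is red in `m` and blue in `m'`. -/
def maskResolvent (v : ℕ) (m m' : Mask) : Mask :=
  (clearBits m.1 (1 <<< v) ||| m'.1, m.2 ||| clearBits m'.2 (1 <<< v))

theorem testBit_clearBits {x v k : ℕ} (h : x.testBit k = true) (hk : k ≠ v) :
    (clearBits x (1 <<< v)).testBit k = true := by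
  simp [clearBits, h, Nat.one_shiftLeft, Ne.symm hk]

theorem Refuted.resolvent {F : Set (ℕ → ℕ → Prop)} {m m' : Mask} (v : ℕ) (h : Refuted F m)
    (h' : Refuted F m') : Refuted F (maskResolvent v m m') := by
  intro f hf hE
  by_cases hv : f (v / 8) (v % 8)
  · refine h f hf fun i hi j hj => ⟨fun hm => ?_, fun hm => (hE i hi j hj).2 ?_⟩
    · by_cases hk : 8 * i + j = v
      · rwa [show i = v / 8 by omega, show j = v % 8 by omega]
      · exact (hE i hi j hj).1 (by simp [maskResolvent, testBit_clearBits hm hk])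
    · simp [maskResolvent, hm]
  · refine h' f hf fun i hi j hj => ⟨fun hm => (hE i hi j hj).1 ?_, fun hm => ?_⟩
    · simp [maskResolvent, hm]
    · by_cases hk : 8 * i + j = v
      · rwa [show i = v / 8 by omega, show j = v % 8 by omega]
      · exact (hE i hi j hj).2 (by simp [maskResolvent, testBit_clearBits hm hk])

/-- A reference to an earlier refuted mask, packed in a number: the pivot cell (6 bits), the colour
of the pivot (1 bit), the row and the column permutation (24 bits each) and an index. Index `0` is
the red cycle of length `8`, and `k + 1` is entry `k` of the list of known masks. -/
abbrev Ref := ℕ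

namespace Ref

/-- The cell resolved upon. -/
def pivot (e : Ref) : ℕ := e &&& 63
/-- Whether the pivot is red in the mask of the reference and blue in the other one. -/
def isBlue (e : Ref) : Bool := Nat.testBit e 6
/-- The row permutation. -/
def rows (e : Ref) : ℕ := (e >>> 7) &&& 16777215
/-- The column permutation. -/
def cols (e : Ref) : ℕ := (e >>> 31) &&& 16777215
/-- The position of the referenced mask. -/
def index (e : Ref) : ℕ := e >>> 55

end Ref

/-- The red cycle of length `8` on the first four rows and columns. -/
def redCycle : Mask := (151782915, 0)

/-- The mask a reference points to, before permuting it. -/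
def Ref.source (cs : List Mask) (e : Ref) : Mask :=
  match e.index with
  | 0 => redCycle
  | k + 1 => cs.getD k redCycle

/-- The mask a reference stands for. -/
def Ref.mask (cs : List Mask) (e : Ref) : Mask :=
  (image e.rows e.cols (e.source cs).1, image e.rows e.cols (e.source cs).2)

/-- The permutations of a reference are permutations of the indices below `N`, and fix `0` if they
have to. -/
def Ref.valid (N : ℕ) (fix : Bool) (e : Ref) : Bool :=
  Nat.beq (digitSet e.rows N) (2 ^ N - 1) && Nat.beq (digitSet e.cols N) (2 ^ N - 1) &&
    (!fix || Nat.beq e.index 0 || (Nat.beq (octDigit e.rows 0) 0 && Nat.beq (octDigit e.cols 0) 0))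

/-- Resolve `m` with the mask of a reference. -/
def Ref.resolve (cs : List Mask) (m : Mask) (e : Ref) : Mask :=
  bif e.isBlue then maskResolvent e.pivot (e.mask cs) m else maskResolvent e.pivot m (e.mask cs)

/-- A refuted mask together with its derivation. -/
structure MaskDerivation where
  red : ℕ
  blue : ℕ
  start : Ref
  chain : List Ref

/-- Check a list of derivations, the masks of which are added to the list of known ones. -/
def verify (N : ℕ) (fix : Bool) : List Mask → List MaskDerivation → Bool
  | _, [] => true
  | cs, d :: ds =>
    d.start.valid N fix && d.chain.all (Ref.valid N fix) &&
      Nat.beq (d.chain.foldl (Ref.resolve cs) (d.start.mask cs)).1 d.red &&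
      Nat.beq (d.chain.foldl (Ref.resolve cs) (d.start.mask cs)).2 d.blue &&
      verify N fix ((d.red, d.blue) :: cs) ds

theorem RedFree.comp {N : ℕ} {f : ℕ → ℕ → Prop} (hf : f ∈ RedFree N) {s t : ℕ}
    (hs : digitSet s N = 2 ^ N - 1) (ht : digitSet t N = 2 ^ N - 1) :
    (fun i j => f (octDigit s i) (octDigit t j)) ∈ RedFree N := by
  obtain ⟨si, sm⟩ := octDigit_bijOn hs
  obtain ⟨ti, tm⟩ := octDigit_bijOn ht
  intro a c ha hc hA hC h0
  exact hf (octDigit s ∘ a) (octDigit t ∘ c) (si.comp ha hA) (ti.comp hc hC) (sm.comp hA)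
    (tm.comp hC) (by simp [h0])

theorem BlueFree.comp {N K : ℕ} {fix : Bool} {f : ℕ → ℕ → Prop} (hf : f ∈ BlueFree N K fix)
    {s t : ℕ} (hs : digitSet s N = 2 ^ N - 1) (ht : digitSet t N = 2 ^ N - 1)
    (hfix : fix = true → octDigit s 0 = 0 ∧ octDigit t 0 = 0) :
    (fun i j => f (octDigit s i) (octDigit t j)) ∈ BlueFree N K fix := by
  obtain ⟨si, sm⟩ := octDigit_bijOn hs
  obtain ⟨ti, tm⟩ := octDigit_bijOn ht
  intro a c ha hc hA hC h0 h1
  exact hf (octDigit s ∘ a) (octDigit t ∘ c) (si.comp ha hA) (ti.comp hc hC) (sm.comp hA)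
    (tm.comp hC) (by simp [h0]) fun h => by simp [h1 h, hfix h]

theorem refuted_redCycle {N : ℕ} (hN : 4 ≤ N) : Refuted (RedFree N) redCycle := by
  intro f hf hE
  refine hf id (· % 4) (fun _ _ _ _ h => h) (fun i hi j hj h => ?_)
    (fun i hi => lt_of_lt_of_le hi hN)
    (fun i _ => lt_of_lt_of_le (Nat.mod_lt i (by norm_num)) hN) rfl fun i hi => ?_
  · simp only [Set.mem_Iio] at hi hj
    simp only at h
    omega
  · have h : ∀ i < 4, redCycle.1.testBit (8 * i + i % 4) = true ∧
        redCycle.1.testBit (8 * i + (i + 1) % 4) = true := by decide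
    exact ⟨(hE i (by omega) _ (by omega)).1 (h i hi).1, (hE i (by omega) _ (by omega)).1 (h i hi).2⟩

theorem refuted_blueCycle {N K b : ℕ} {fix : Bool} (hK : 0 < K) (hKN : K ≤ N) (hN : N ≤ 8)
    (hb : ∀ i < K, ((fix = true → i ≠ 0) → b.testBit (8 * i + i % K) = true) ∧
      b.testBit (8 * i + (i + 1) % K) = true) :
    Refuted (BlueFree N K fix) (0, b) := by
  intro f hf hE
  have hlt (i : ℕ) : i % K < 8 := by have := Nat.mod_lt i hK; omega
  refine hf id (· % K) (fun _ _ _ _ h => h) (fun i hi j hj h => ?_)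
    (fun i hi => lt_of_lt_of_le hi hKN) (fun i _ => lt_of_lt_of_le (Nat.mod_lt i hK) hKN)
    (by simp) (fun _ => by simp) fun i hi => ?_
  · simpa [Nat.mod_eq_of_lt (Set.mem_Iio.1 hi), Nat.mod_eq_of_lt (Set.mem_Iio.1 hj)] using h
  · exact ⟨fun h => (hE i (by omega) _ (hlt i)).2 ((hb i hi).1 h),
      (hE i (by omega) _ (hlt _)).2 (hb i hi).2⟩

theorem Ref.refuted_mask {N K : ℕ} {fix : Bool} (hN : 4 ≤ N) {cs : List Mask}
    (hcs : ∀ m ∈ cs, Refuted (RedFree N ∩ BlueFree N K fix) m) {e : Ref}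
    (he : e.valid N fix = true) : Refuted (RedFree N ∩ BlueFree N K fix) (e.mask cs) := by
  simp only [Ref.valid, Bool.and_eq_true, Bool.or_eq_true, Nat.beq_eq, Bool.not_eq_true'] at he
  obtain ⟨⟨hs, ht⟩, hfix⟩ := he
  have hred (h : e.source cs = redCycle) :
      Refuted (RedFree N ∩ BlueFree N K fix) (e.mask cs) := by
    rw [Ref.mask, h]
    exact ((refuted_redCycle hN).image fun f hf => RedFree.comp hf hs ht).mono Set.inter_subset_left
  cases hi : e.index with
  | zero => exact hred (by simp [Ref.source, hi])
  | succ k =>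
    have hsrc : e.source cs = cs.getD k redCycle := by simp [Ref.source, hi]
    by_cases hk : k < cs.length
    · refine (hcs (e.source cs) ?_).image fun f hf => ⟨RedFree.comp hf.1 hs ht,
        BlueFree.comp hf.2 hs ht fun h => ?_⟩
      · rw [hsrc, List.getD_eq_getElem _ _ hk]
        exact List.getElem_mem hk
      · simpa [h, hi] using hfix
    · exact hred (by rw [hsrc, List.getD_eq_default _ _ (not_lt.1 hk)])

theorem Refuted.of_chain {N K : ℕ} {fix : Bool} (hN : 4 ≤ N) {cs : List Mask}
    (hcs : ∀ m ∈ cs, Refuted (RedFree N ∩ BlueFree N K fix) m) (ch : List Ref) {m : Mask}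
    (hm : Refuted (RedFree N ∩ BlueFree N K fix) m) (hch : ch.all (Ref.valid N fix) = true) :
    Refuted (RedFree N ∩ BlueFree N K fix) (ch.foldl (Ref.resolve cs) m) := by
  induction ch generalizing m with
  | nil => exact hm
  | cons e ch ih =>
    rw [List.all_cons, Bool.and_eq_true] at hch
    refine ih ?_ hch.2
    have he := Ref.refuted_mask (K := K) hN hcs hch.1
    rw [Ref.resolve]
    cases e.isBlue
    · exact hm.resolvent _ he
    · exact he.resolvent _ hm

theorem refuted_of_verify {N K : ℕ} {fix : Bool} (hN : 4 ≤ N) (ds : List MaskDerivation)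
    {cs : List Mask} (hcs : ∀ m ∈ cs, Refuted (RedFree N ∩ BlueFree N K fix) m)
    (h : verify N fix cs ds = true) :
    ∀ d ∈ ds, Refuted (RedFree N ∩ BlueFree N K fix) (d.red, d.blue) := by
  induction ds generalizing cs with
  | nil => simp
  | cons d ds ih =>
    simp only [verify, Bool.and_eq_true, Nat.beq_eq] at h
    obtain ⟨⟨⟨⟨h1, h2⟩, h3⟩, h4⟩, h5⟩ := h
    have hd : Refuted (RedFree N ∩ BlueFree N K fix) (d.red, d.blue) := by
      rw [← h3, ← h4]
      exact Refuted.of_chain hN hcs d.chain (Ref.refuted_mask hN hcs h1) h2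
    rw [List.forall_mem_cons]
    exact ⟨hd, ih (List.forall_mem_cons.2 ⟨hd, hcs⟩) h5⟩

/-- Refutation of the empty mask in `K_{5,5}` without a blue cycle of length `4`. -/
def fiveCert : List MaskDerivation := [
  ⟨51540198912, 184549384, 71320977037995008, [35293517900842049, 71321112329464832]⟩,
  ⟨51540395281, 8590065664, 107340995143209216, [35266219088629860, 35266219088644180]⟩,
  ⟨38655296256, 8841725952, 143369792162246656, [35266339347728484, 143369792162834452,
    71322314920379460, 143379908958235648, 35292180018464833, 107351111939343363,
    143379653406560674, 143379653407608082, 143377473711770762]⟩,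
  ⟨38990839808, 8590072836, 179408450426048768, [35263889067904098, 35263889068018770,
    179397491817661444, 179406270730814467]⟩,
  ⟨590592, 8774617088, 215426288836610176, [35267421678619732, 35267181160451154,
    215417494891086852, 215436300405320704, 143376752157213123, 71322314920379394,
    143379638375171530, 143362050484094412, 107333794631205916, 107351111939343386,
    215436165112730019, 215437502995042720]⟩,
  ⟨34359804682, 453117952, 251456318510010752, [35272938564964452, 35276786855661664,
    251456183219588372, 251446291909971084]⟩,
  ⟨60398568202, 134219776, 287483882874538112, [35257545401329748, 35259469547008076,
    287492661787626650, 35290255873101906, 35292180018636874]⟩,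
  ⟨43219747594, 17314088960, 323521458806590592, [35281717478640730, 35293262350402634,
    323512679892922370, 35272938564964452, 35273509795801156]⟩,
  ⟨43218699018, 86051391488, 359550255825554560, [35292555828088906, 359552570812935168,
    35281476960472154, 359541476911886340, 35290120581689410, 359541476911812882]⟩,
  ⟨768, 184682496, 179391388669133824, [143360426986645594, 71322314920379428, 107351111939343444,
    143379908958307426, 179408705977271324, 215437502994138625, 215435338330614275,
    215435338332710947, 215437502996235297, 395580150208597267, 395581488090909968]⟩,
  ⟨43016913665, 17314094080, 431607849863547008, [35273915670024275, 35282574324616274,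
    431599070950409220, 35282814841752642, 431599070949806244, 431590277004790940]⟩,
  ⟨42950398723, 17179869184, 467627867968704768, [35291473496344658, 467627867968778242,
    35277162665314404, 35277162665300052, 35275839815451716]⟩,
  ⟨12952208131, 17314089984, 503665443901490176, [35276922147131459, 35282814842447938,
    503647871042653460, 35285821319899228, 503665443901474962, 71322314920379475,
    107351111939343372, 503665443900887203]⟩,
  ⟨25836978947, 134224896, 539676668061747328, [35291353237260371, 539685462007285906,
    539676668061762563, 35285821318393940, 35282574323584068, 539676668061682844]⟩,
  ⟨25770005253, 402653184, 575705465080581376, [35291082654492755, 575705465080654851,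
    35285701060284500, 35282303741346884]⟩,
  ⟨12885099267, 134220800, 143379908956226816, [71322314920379458, 35285821318852700,
    107351111939343372, 143379908958307362, 611751834958302362]⟩,
  ⟨47245825283, 134217732, 647780631977338880, [35282574324286546, 647763059118582788,
    35283897174550620, 647780631977274394, 35277162665300051, 35276922147131459]⟩,
  ⟨12886152963, 134217728, 107351111938289664, [71322314920379491, 35285821319426146,
    35282814842455106]⟩,
  ⟨335746561, 1310720, 719829447102113792, [35282574324673604, 35282814842842178]⟩,
  ⟨512, 184551424, 395581367831970816, [71322314920379482, 107333794631205970, 395563810005664796,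
    107351111939343444, 179391388669133836, 179408705977271306, 395581473057637408,
    395581488090022945, 395581488091038977, 395581473058669584, 395581473058653440,
    395581488091055121, 755868255689772168]⟩,
  ⟨8875278848, 34360265728, 71295677533087744, [719804282888537548, 791895820052598946,
    791895820053186706]⟩,
  ⟨352453120, 34528036864, 71322314919325696, [755833079907494370, 71304997612234772,
    71322314920379402, 827925714435117473]⟩,
  ⟨43302392584, 0, 863945867832995840, [35285821317941476, 863955729077907490, 35282574322715872,
    35273509795277892, 35290120581230658, 35276922146730048]⟩,
  ⟨34712191496, 134745088, 899973432196345856, [35272938564448356, 35283401105892420,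
    899984390805401601, 71322194661166178, 71322194659069506, 71322314920379489,
    179382068589979660, 179408555653286920, 899982211110078610]⟩,
  ⟨352322048, 168298496, 71322044337432576, [71322194661223504, 71304997612234772,
    71322314920379402, 143379908956210691, 143379908958307363, 936012105493056785]⟩,
  ⟨352977432, 134219776, 251466149691214848, [35256192488057930, 35273509796195400]⟩,
  ⟨352846344, 167774210, 287484093327756416, [71287409721164864, 71322314920379460,
    107348947275825297]⟩,
  ⟨34712585738, 0, 1044089852927742208, [35257545401659492, 35292180017934432, 35257545402706004,
    35292180018980944]⟩,
  ⟨0, 167774208, 359552540748106752, [71322044337439816, 71322314920379466, 107351111939343361,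
    179408705977255171, 179408705976239139, 179408705977271315, 359534832598074396,
    359552420489151514, 359552691072091160, 1080127293568978057]⟩,
  ⟨43083891974, 33554433, 71319158119415936, [35293262349886552]⟩,
  ⟨43083891712, 17213425665, 107349037469944960, [71322314920379457, 107350134833565826,
    107347849911558408]⟩,
  ⟨43151001091, 2048, 143376646929993728, [35293517900440672, 35292555827572808]⟩,
  ⟨134218240, 17213425664, 179406541313559680, [71320150256733251, 71322314920379457,
    107351111939343360, 179406661571849249, 179407743903543322, 179408585717728291,
    179407503385776138]⟩,
  ⟨86302326785, 3328, 539696525842931968, [35266339346746435]⟩,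
  ⟨94624875013, 2048, 575708877432114176, [71322314920379484, 35285701060341836,
    35285701060363338, 35282814842275912]⟩,
  ⟨0, 33556480, 287492932369656832, [71302291782700387, 71322314920379489, 143379908957275154,
    143379638375367712, 143379638373287168, 143362591650169892, 143379908956226818,
    143362591648089348, 143362591649137684, 143379638374335504, 143379908958307362,
    287492932370517001, 287495097034163227]⟩,
  ⟨73316696069, 2048, 71322314920322048, [35285701059438673]⟩,
  ⟨0, 2048, 107349909348376832, [71322314920379458, 107347849911558400, 107351096906499104,
    107350991680201746, 107333433853953052, 107333433853494308, 107351111939343385]⟩,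
  ⟨202381317, 0, 71319173151795200, [35268383752727632]⟩,
  ⟨0, 0, 107343415357948928, [71322314920379468, 107347970170765440, 107350149866668162,
    107343415357941780, 107350149866597402, 107351111939271707, 107351111939343371]⟩]

/-- Refutation of a blue cycle of length `4` in `K_{6,6}` without a blue cycle of length `6`. -/
def sixCert : List MaskDerivation := [
  ⟨3371717099520, 133907, 71312333416376320, [35273509777420628, 71321352847697939]⟩,
  ⟨19885883326464, 268962065, 107321483107322880, [35291082653453379, 107349067534903298,
    35283897155818842, 35282814824067410]⟩,
  ⟨152109060, 51875154193, 143350280125189248, [35267992910646348, 143368965381565450,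
    143350280125254659]⟩,
  ⟨12985761828, 13228499533824, 179308860862411008, [35211952175927397, 35211952175941717]⟩,
  ⟨20972325306368, 8830721198867, 215347549200592896, [35133332782297445, 215347549201180693,
    71322314920379461, 35283897155826026, 35285701042154834, 107351111939343386,
    215435458591207426, 143379908958307426, 215436540923560976, 215417900765489172,
    35276786837531987, 179408705977271313, 215417900765424667, 215427521492167705,
    215427386200697880]⟩,
  ⟨3371583930368, 8796227242757, 251466179756107776, [35282303722959186, 35283401087103313,
    251464255605978154, 251464255610694682]⟩,
  ⟨3380461174820, 8830452760576, 287395251915108736, [35123441485834346, 35132791616418149,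
    35132791616482653, 35123441489905754]⟩,
  ⟨3509308096548, 8796229339392, 323521729389415552, [35133453041381712, 323424048942445869,
    35211952163369050, 35127289780531282]⟩,
  ⟨20972594790400, 8830586981123, 359452845957230848, [35283897155826026, 359452845965603098,
    107140418023212114, 359461880430350481, 359462977794494608, 71322314920379493,
    107351111939343445, 143169215034835973, 143379908958307330, 359551728999345177,
    359551728999359512]⟩,
  ⟨807932968, 131841, 395581367831963648, [34976109080751186, 34978409035688002]⟩,
  ⟨3311419785216, 8830452763411, 431510680513844352, [35264144610207842, 431610164850934786,
    71322314920379466, 35056923175465061, 431520571827713181, 431520571828229269,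
    431520331310183429, 287475088907585261, 431600303606023180, 431609082519176195,
    35273509777420633, 35272547704746328, 35272938546834769, 35274035910978896,
    107351111939286035, 107351111939343387, 251466300015141908, 251466300015199260,
    431590682874491948, 431590682878685220]⟩,
  ⟨7709466492980, 8830453286912, 71049416991772928, [467609708846928010, 35123561741198434,
    35123561745785938, 467398639121617037, 467398759380701324, 467398759371288877,
    467398639112204588, 35211952167669861, 35282303731978340, 35211952167684181,
    35282303731992660]⟩,
  ⟨3311419785268, 8830453287683, 107078213998155264, [35128372113264740, 503567898741609749,
    503568274551248146, 503567898742133901, 503568274551772298, 35132791625258093,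
    35132791625265253, 503638250305918228, 503638250306442380, 71322314916709474,
    71304997612242028, 71322314920379498, 503666917075265553, 503666917075272720]⟩,
  ⟨3311420440604, 8796093028352, 539667047325413504, [35290120572471402, 35273509786267748,
    35290120572414050]⟩,
  ⟨3380543488060, 8830469540096, 575625492780061824, [34979371108362317, 575625868589700234,
    34979371106864229, 34978409034311778, 575635759903569053, 575635759904085141,
    575723308517446802, 35056923175457901, 35264144610265194, 35272547713593424]⟩,
  ⟨3311554527284, 8830452767491, 215231814850405888, [179379077124015717, 35291082645088336,
    215417494876546594, 71322314920379492, 611744649478038556, 107351096903230552,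
    611744649478088724, 107351111939343441, 215437502996234371]⟩,
  ⟨38495926694964, 8899172237312, 647753573673251072, [35123561741255786, 647613111071174949,
    35203804605754717, 35196559008945242, 35128372109092948, 35123561745785938]⟩,
  ⟨38495926629428, 8830452762880, 683809699578015872, [34977206444967002, 35196559008887896,
    683792382270394516, 683809699578531986, 71322314920379472, 35128372104376420,
    35123561741198434]⟩,
  ⟨4698158132, 44014824851712, 719750947979940992, [35264024359488592, 719740816146863394,
    34979250849270869, 34977206444909650]⟩,
  ⟨3298534883328, 8830452763395, 755839964730135808, [34979250849278036, 34977326703993938,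
    35128372108555372, 35123561749570658, 755628879968245149, 755849976307806360,
    107289539284517988, 71322314920379484, 107351111939343469, 179391388669133834,
    179347133326115853, 179408705977271308, 287495097034105883, 287495097034163219,
    359491118420935685, 359535373763953666, 359552691072091140, 755868496207425569,
    755868496207447072]⟩,
  ⟨19838605459456, 8796093025043, 611746573614153856, [791888273795591193, 35276922128937308,
    791888273795655697, 791888138504185872, 35272547704739156]⟩,
  ⟨18730354216968, 197121, 827926932059538432, [35266910568486090, 35267992900776002]⟩,
  ⟨20925215408128, 8864812501779, 863955849337579520, [35267992901234762, 863955729078495234,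
    71322314920379474, 863945867833590796, 863954646746743811, 863945867833583636,
    35272938546834769, 35274035910978896, 863945732542049308, 107351111939343448,
    863945867832995873, 863945732541526048]⟩,
  ⟨19877511954432, 8796109801728, 899982481687606400, [35257545384103274, 35259469529451866]⟩,
  ⟨20994204499968, 8796093025043, 755857417330590720, [35277162647227728, 936012240784614425,
    35256327773441228, 35256448033049667, 936011278702384298, 936013443374941194,
    936013187824365570, 71322314920379490, 35272938546892128, 35272938546884952]⟩,
  ⟨19791613530120, 8942138886915, 972042240394471424, [34979371108412498, 34979371108362314,
    972040195985257474, 539456233147205354, 971962388361343005, 971962388361859093,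
    971962388361916429, 971961907325579269]⟩,
  ⟨206562131976, 13194173155587, 1007991185381346304, [34978409034189917, 34979371106864213,
    1008068872745014418, 1008068993004221442]⟩,
  ⟨22230752301096, 197377, 1044099714173315072, [34976109080227922, 1044099714173322250,
    34978168507813954]⟩,
  ⟨3333029363712, 8796093025043, 143379893923890560, [71322314920379461, 107351111939343402,
    143379908958307365, 179408705977214041, 179408705976697953, 179408690944828504,
    1080118649947374604, 1080127428860527619, 179408690944885840, 179408705977271377,
    251466300014740508, 251466300014224404, 251466300015199268, 1080109029215843372]⟩,
  ⟨7743960776756, 44117904067328, 1115987081475682560, [35293517882561890, 35292315291726170,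
    1116067715188028568, 1116066617824400529, 1116067715188544656, 35193672782679133,
    35264024346987612, 35193672786872405, 35264024351180884]⟩,
  ⟨3345914265652, 48515950578947, 1152175522425369728, [35266910569010284, 34976935860471900,
    35291082640895064, 1152105291120661653, 1152186225489291282, 35290120572414033,
    35291082645088336, 1152086620893123746, 1152184060820993027]⟩,
  ⟨3337324602420, 48515950578176, 1188045066343068032, [35291082636112218, 1188194443167036569,
    35266910569010284, 34976935861568612, 34976935862027356]⟩,
  ⟨3414633948180, 48378511884289, 1224241654858347520, [35276200574424408, 1224073743111320876,
    35274035911036252, 35266910577447002, 35128372113264725, 35273509786267715]⟩,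
  ⟨3333029363764, 44117904067331, 1260102660380995968, [35273915651951964, 35266910577461338,
    1260102660385190164, 71322314920379492, 1260269354513618065, 1260270451877762192,
    107351111939343442, 143379908958307338, 539619710349296653, 179408705977271402,
    1260181805895554209, 1260182903259698336]⟩,
  ⟨3470487191604, 8796093025025, 1296271784727850112, [34978409035171916, 1296272040278389898,
    1296300210973737987, 1296281931583886500, 35196559013081184, 34979250847779932,
    34977326702495834, 1296280834224444564, 1296298151532582034, 35052939597670508,
    35193672791058538, 35202196140437857, 35202466723492177]⟩,
  ⟨2371495657524, 8796378237187, 1332330210582949888, [34979250847901794, 35045243012089953,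
    34979250847844442, 1332320589857253396, 35045243016268881, 1332310728607036588]⟩,
  ⟨3333029363764, 43980465113859, 71304997612184576, [107351111939286096, 34979250847779922,
    71322314920379420, 1368269294320776349, 107351111939343448, 143379908957332501,
    143379908958307365]⟩,
  ⟨42915449012276, 3, 1404387804620877824, [34976935852020834, 35256327769786465,
    34976935856206938, 35264024355367000]⟩,
  ⟨42915448094772, 1048579, 1440416601639848960, [35196559004701792, 35187900354819161,
    1440246645488382226, 35185976205463653, 35256327769772132, 35187900350747746,
    35185976209656925, 35187900354876506]⟩,
  ⟨0, 8796093025027, 431610285110002944, [1476444196069131267, 71322299887993936,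
    71322314920379473, 107351111939343444, 143177873696703530, 143379908958307373,
    431548712458863621, 431592967801881602, 431610285110019076, 755869458279719955,
    755869458280236059, 755869458280694819, 1476444436582511657, 1476444436582540328]⟩,
  ⟨17661177629724, 10995116278019, 1512374591078045056, [34978409035351138, 34979371108355163,
    34978409035809882, 1512394343642182669, 34977326699205741, 34977326703399013]⟩,
  ⟨17661175008284, 15393162855171, 1548403147578847616, [34979371107846245, 34978168517067875,
    34979371108362333, 34978168517641306, 1548423140665934861, 1548422524338120709,
    71322314920379477, 1548502030620382227, 1548502992693056530]⟩,
  ⟨19791209434140, 13194139599105, 863952451995986560, [35258251920102483, 35257154555958354]⟩,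
  ⟨68989226012, 13194139738883, 1620460741616775552, [34976229339254885, 34977206444329059,
    34976229339778141, 34976109080701018, 1620480734703855637, 1620480253667525637]⟩,
  ⟨18696262396956, 39582955602689, 1656509050686482432, [34979371108355157, 34978168517583941,
    1656489403344262555, 35266910569469027, 35265813205324898]⟩,
  ⟨17661175008268, 13194139603715, 1692518576172864896, [34978409035351138, 34979371108355163,
    34978409035809882, 1692538328741152789, 71322314920379488, 34978409031050349,
    34978409035236453, 34978409035752541, 107351111939343373, 251465337942517778,
    179408690944885800, 143379908958307409, 179408705977271337, 251454259062399108]⟩,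
  ⟨17670083904532, 8813273678339, 1728567125755995136, [35136700036779368, 1728547373196023077,
    35137662109331821, 35128372113795149]⟩,
  ⟨17674110438420, 8796093022979, 179406270714383616, [71322314920379485, 35266910578378851,
    35282303740307554, 35266910578894939, 35282303740250202, 35266910578887763,
    35282303740185682]⟩,
  ⟨19873266860044, 13194139533312, 1800604967233950976, [35136219000320357, 1800604726715782421,
    1440063009849578861, 35276200574424419, 35291082653453410, 35276922129001811,
    35291082653338706]⟩,
  ⟨19873134608396, 13194274013184, 1836633764248720768, [35291082653460578, 35291082653403226,
    1836633764257115411, 35136219000313197, 35136219000320357, 35136219000384861]⟩,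
  ⟨3084, 13194139538179, 1872662320753710336, [35291082653388899, 35283897155818850,
    1872662320757896474, 35137662109331821, 1872662320757910813, 71322314920379477,
    107323752997094482, 107351111939343451, 431599341533348009, 431598244169203880,
    143379908958307396, 215437487963849745, 215437487963276321, 215437487963792409,
    215437502995661856, 215437502996177944, 215437502996235280, 431602588516639764,
    431602588520825884, 431602588528624684, 431602588524954660]⟩,
  ⟨19791209438220, 14293652472065, 1512470798341010688, [35259334251882579]⟩,
  ⟨7196, 14293652472067, 1224231643272475904, [71322314920379500, 503666917062685737,
    1944819759901681681]⟩,
  ⟨3298535609356, 13194140844035, 143368694777722112, [35267992905951340]⟩,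
  ⟨7196, 13194140844803, 179406270709836416, [71322314920379475, 107343400313005073,
    107351096906957865, 107343415345390608, 107351111939343400]⟩,
  ⟨537671708, 13194140581888, 611728745201471104, [34977326703979612, 34977326703993947,
    34976229339849818]⟩,
  ⟨67704852, 269484035, 647775370630409216, [35256327779599449, 2088925327255496721,
    35264024360993880]⟩,
  ⟨15420, 13194140582659, 683804167653566464, [35256327779599441, 2124954124274453529,
    71322314920379472, 34976109080765532, 143318336307094554, 107351111939343453,
    143378946885633043, 143379908958307346]⟩,
  ⟨2056, 13194139534083, 1440414166372157824, [1368016960683856337, 34979371107846227,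
    34979371107910738, 179347133318202405, 34979371107831907, 34978409035351138,
    71322314912465956, 34979371108355163, 34978409035809882, 71260742269223957, 71322314920322076,
    71322314920379412, 323462321401971725, 323462321401970821, 323523894053126276,
    323523894053127180, 719839699189056522, 719839699189055618]⟩,
  ⟨39673419268096, 134750755, 2197020376966450176, [35119848732471641, 2196941005970949137,
    35125756460051792]⟩,
  ⟨57244132576264, 8963, 107351111935673344, [71322314920379490, 791815862790865056,
    34979371098132707, 34979371102325979, 34979371102333139, 34976109075998789]⟩,
  ⟨57381636866048, 4625, 2269068951572612096, [35115865150297441, 35128883196243296,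
    2269068951573128217, 35128883196171608]⟩,
  ⟨57312582567944, 8979, 863943808384786560, [71322314920379472, 107149076665295948,
    863954887257113626, 863954887252927506, 107351111939343434, 863948152748392604,
    863948152752521380, 863948152744206484]⟩,
  ⟨57175143615512, 8448, 215272357192535296, [34976229334559836, 34976229334545498,
    34976229335083092, 34976229335061586]⟩,
  ⟨57248225165312, 34494481923, 2377164362060746752, [35115744891213153, 2377164362061270041,
    2377165324134073362, 35127560346316112]⟩,
  ⟨57174604646408, 8963, 2413193159079201792, [35120089250633049, 2413192076747901074,
    2413193159079725073, 71322314920379488, 34976229325779035, 287477779722355748,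
    34979115543852131, 34979115552109651, 972041278314005530, 107351111939343434,
    143379908958307332, 971965274572735517, 971965274568549397, 971965274576864293]⟩,
  ⟨57191784527912, 771, 323506576741319680, [34978033216623716, 34976109071475811]⟩,
  ⟨0, 8796093022979, 1044092137847341184, [359544994487026756, 34976109071282276,
    359475725254476837, 71322314920379490, 107289539288187916, 107149076677739530,
    107351111939342469, 107351111939343373, 359535373763953708, 359465142458729517,
    359552691072091178, 1044099834432405635, 1044099834432406539]⟩,
  ⟨26440357904384, 771, 71314618331186176, [34977206426185052]⟩,
  ⟨0, 771, 107343415357948928, [71322314920379500, 107350149862999074, 107351111935673379,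
    107274146113414165, 107350149854684178, 107274146117600285, 107351111939343403]⟩]

/-- Refutation of a blue cycle of length `6` in `K_{8,8}` without a blue cycle of length `8`. -/
def eightCert : List MaskDerivation := [
  ⟨1513209496271331620, 146031051265, 71166098369315840, [35123441180140620, 35125094742721604]⟩,
  ⟨21474844964, 2305843155245008387, 107195255854133248, [35123441180312676, 107195255859373068,
    71322314920379516, 107274145818666042, 107274145818952760]⟩,
  ⟨2305843030688538884, 146031329795, 142737244105139200, [33997695892077694, 34002506255642746,
    142098428155560998, 142097826860139526]⟩,
  ⟨2305843305566462244, 4611686164458702339, 178765304537111552, [34002506255642694,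
    179328853633617978, 34003588587207800]⟩,
  ⟨8224, 146031314435, 214798430877575296, [33997695892120696, 214794237153783814,
    71322314920379494, 33997816151161982, 107351111939343374, 143379908958307389,
    215360537181717538, 215360537181832224, 215357650963615752, 215360416922633218]⟩,
  ⟨13510833244483672, 8590263299, 250823635468169216, [32727489689768038, 32727624943584334]⟩,
  ⟨13510798884220944, 2533283380659715, 286851695862437888, [32728827529839734,
    286851831191711782, 71322314920379462, 287494841439668387, 287495096996086803,
    287493759113451523]⟩,
  ⟨28728061285392432, 658437, 323521849644106752, [33356805402117225, 35123170793855080]⟩,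
  ⟨328350511772205056, 658437, 359550646361211904, [35293396415667833, 30129832113723000]⟩,
  ⟨65302194600046640, 281552286451203, 395581487784221696, [35291472270448249, 395580525711934520,
    71322314920379514, 390361281750741039, 395564170773377067, 395571867354771498,
    395573671241286696, 107351111939343468, 395581488090402850, 33361615803500625,
    28226071863334991, 28222223572637771, 35052939560196168, 33291775340587074,
    395580150170372146, 395579323389454385, 390434639801102375, 395580285499617315,
    395579323427072032, 32728571983808595, 14713520639326279, 32728827534649411]⟩,
  ⟨69806069105307704, 281483566990851, 70683498664640640, [35263889026422856, 430966538231359520,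
    431610164850361363, 431609323036749835, 33291775335777346, 430967620525507634,
    32728827529839715, 430971468853686306, 32728827534656598]⟩,
  ⟨12384955078279216, 788995, 467638120056308736, [34975973741664346, 35123170860832856]⟩,
  ⟨3158064, 281689725404675, 503658258411663360, [34633295375749610, 503511061288022056,
    68506688975349868, 35125095006375005, 503650561838641179, 503658258420035610,
    503660062306436120, 71322314920379484, 35123170865420360, 34977326661157954,
    503666917037196338, 503667879147352098, 503665714483963936, 32728571978618966,
    32725685760596051, 32725685761054795, 32727489647333446, 503666676556509219,
    107351111939343427, 503025214600917030, 143379908958307406, 245278248574075959,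
    249780748689818678, 251466300015199283, 503590657739507893, 503659926972057780]⟩,
  ⟨5497642024960, 4558790762432259, 71076445208212992, [539687055430620194, 539540820379595808]⟩,
  ⟨429909131399188, 4556591202567939, 107105242227192192, [575569617398574112, 30152201377060313,
    570505266812014647, 570579346450370599, 570584156813742114, 30057287041919063,
    30057287042442319]⟩,
  ⟨73470466566664244, 214748694019, 338973880047693440, [67381665217070198, 605318469864707481,
    30057286740468863, 605313854653920697, 30057287008896119, 605313854922347953,
    28789275262927967, 606534063864066071, 606534063864524815, 71322314920379503,
    107351111939343401, 35123561443353725, 35123561711780981, 35123441452696692,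
    35123561745327213, 35123441486242924, 35123561745441885, 35123441486357596,
    35123561750538312]⟩,
  ⟨941608843077492784, 77577847043, 647765749914497024, [34637143397940699, 35052938990117963]⟩,
  ⟨4977890460772081712, 2305878408871282439, 683563844492391808, [34654580965176825,
    683563844492377513, 35265813167241315, 35265813167183963, 683792381959576579,
    71322314920379515, 34566792102066652, 34567032083380732, 683094158018195502,
    34564627438621164, 683169199695679526, 683173047986376738, 683168117364107296,
    682531345512099870, 33364501446191190, 33364501446714446]⟩,
  ⟨294146848304687152, 6917599612744237056, 718471255883568512, [35285820361792985,
    718471706586771897, 33364501983511670, 35125094972749941, 717273805848157612,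
    35052939526972523, 35052939564704859]⟩,
  ⟨366204442344693808, 214748694279, 753937961674143104, [35292554870570457, 35267420721904124,
    755781909355819067, 753935376103873977, 35266338390267372, 755781909657792555,
    34490006782242918, 755868496207425571, 755781909666164763, 71322314920379467,
    33364501983569006, 33364502021301342, 754588939239682062, 754583527580867590,
    107351111939343486, 35125094435945597, 35125094972814445, 35125094972828765]⟩,
  ⟨290206198630711296, 2319354023381894407, 323277888545739136, [791818403266530338,
    791741437406137376, 35292554870520281, 791897292920151099, 35292314352351737,
    791880937947975731, 791810706684669979]⟩,
  ⟨362123055150403632, 2319389207484695299, 820857937575924096, [28226071901612139,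
    28226071905798247, 820857937038997923, 29989310594446427, 822706845986680847,
    822700351996136455, 30152200571714047, 30147390208457207, 30146533362431455]⟩,
  ⟨361982318717472816, 2306001553904959491, 843375851692422528, [14715685341063263,
    863238143112556566, 34650115809918462, 34650115809932782]⟩,
  ⟨282576656306416, 9024998672957440, 897418753284150656, [29989310560914547, 24364191927333998,
    28226071906314331]⟩,
  ⟨2105376, 214748694019, 915435490403203456, [34650852396881398, 915433566257976750,
    929576876383842729, 14715685340547175, 915433175415838118, 71322314920379487,
    935295737158856726, 935290325500529670, 107351111939343454, 930793237035200527,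
    930786743044641799, 143379908958307439, 431610285101760665, 215375930315719789,
    215437502966875244, 215437502899897436, 179408705977271315, 431548711825785009,
    215437502761354364, 215375930345079925, 215375930248741981, 215375930110198909,
    215437502996235380, 359552420489150664, 359552691072091202, 467639082032645144,
    467639082099622952, 467638811311161530, 467638811516682410, 467638811449704602,
    467638811546042546, 467639081894102072, 467639082128983088, 755807885629539348,
    936003822648176652, 936003461870923780]⟩,
  ⟨9224794358226616352, 146029741571, 972032619361289216, [28226206886234196, 28223320668347468,
    972041278015357963, 972040902205368323, 971962388050538557, 972042240087745595,
    30127021057498746, 30128945202847352]⟩,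
  ⟨2534374302031872, 9511637743408317955, 1007991185069502464, [29426361873978621,
    1008071037106709563, 1002268521180478639, 1002924910371857423]⟩,
  ⟨291623228518981632, 14987979705917964803, 1043943016274522112, [14713640936157268,
    1038316815275651087, 1042813903732579334, 1043939769279683588, 33850092826374397,
    34632934636245192]⟩,
  ⟨1413800156733472, 9042529656571395, 1078196052550794368, [28222223605925996,
    1069842150110979095, 1079398057207544836, 71322314920379470, 34630603505000062,
    35263887842860668, 107351111939343418, 143379908958307455, 1080041082794463283,
    1080041082828009515]⟩,
  ⟨1413817345515552, 9042529656046083, 71310499465348096, [1116146725411366944, 29352208036021314,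
    1116000610581336116, 1116000610614882348, 28226207197268052, 1110374409615552527,
    28223320979245132, 1116069879847432203, 1116067715183907843, 30128946310075759,
    30127022164791659, 35195867514636488]⟩,
  ⟨927721857120, 25770131971, 251327761548529664, [28226207197332556, 1152185022897882115,
    19215043687698507]⟩,
  ⟨1408302598594592, 9042529656047107, 142248391234225408, [71322314920379462,
    1188135170432735281, 1188135170466288681, 107351111939343458, 137746011377583127,
    143379908958307347, 1188135170466295850, 1188137801133369512]⟩,
  ⟨1447065215311872, 66051, 1224227464291705856, [35123170755532252, 35193537352226267,
    35123170789086548, 35193537389974731]⟩,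
  ⟨2307285658663649312, 9011743330993667, 1260262499443891200, [35052939488580676,
    35056486019677820, 35199113293707896, 1260185067889283123, 1260272616541430827]⟩,
  ⟨281822871707648, 369858265427019523, 1296291296462855168, [32727865499463748,
    1296211700245174275, 32725429941104892, 1296300450878978107, 33929945197760755]⟩,
  ⟨2307285946965434400, 9570295237379587, 1331049691811532800, [33927449813503350,
    1331687546037625886, 71322314920379470, 35193536848911738, 35195460994260344,
    35193537452887386, 35195867481147592, 107351111939343379, 143379908958307434,
    1332250358508591138, 1332252989175793824]⟩,
  ⟨2342716884537319424, 9007336702346243, 1363212880561396736, [28223320659127679,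
    1368203151178259516, 29422062875762041, 28223320927554932, 29423987625086304,
    1363212880868101151, 29422063479737689, 29431128016718024]⟩,
  ⟨11569466621112098848, 1025, 1404377101563544576, [29418485134564825, 29427279080103384,
    28222222959435092, 29418485168119121, 28222222963629260, 29348118576143426]⟩,
  ⟨2307813987424673824, 9007345292346883, 1440400246405489664, [35055825131462108,
    29430721496276443, 35055825165016404, 29430721534024907, 1435275284963083320,
    71322314920379519, 1440329052984102963, 107351111939343443, 1434633582752223287]⟩,
  ⟨2306969837379788848, 9007345283957251, 1476444436280566784, [28226071594441851,
    34976935210441850, 1475075632609414323, 14715685339565150, 28226071904816219,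
    14715685340611662, 28226071905862731]⟩,
  ⟨1444277254094848, 9007336694022161, 1512306434212796416, [28860663942467956,
    35125094934435170]⟩,
  ⟨927715041312, 9007345283958275, 1547842409241132032, [28226207187489995, 14712543562780742,
    14713520289870206, 28223906855121275, 1548492875897590828, 71322314920379496,
    107351111939343428, 130449651687179284, 143379908958307351, 251466300015199281,
    395581487562572861, 395581488082797597, 395581488091055149, 1548423140622389298,
    1548425771289462960]⟩,
  ⟨9851624721743872, 3377699720857099, 1584529625014548480, [35207652875593945, 35207652875421912,
    1584531789678560275, 1584529625015007249, 1584530827605885963, 1584528527650805768]⟩,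
  ⟨28992782142054432, 1025, 1620558542331397120, [19846043055411417, 19853739636805848,
    19217809603463379, 19846043059540177, 19218080186288331, 19781268511556674]⟩,
  ⟨11013636715716640, 38280605422913035, 1645018731040723968, [32727865489535214,
    28224403309490399, 1656588181163313171, 1656569901783067660, 1656588181163377675,
    19859346720968904, 14715685340726340, 14712543562270956, 19776894086318306, 14712543570528476,
    19215043686271195, 1655920367398115350, 19846163318853841, 1655929161343711246,
    71322314920379510, 1651416905209698327, 1651425699155294223]⟩,
  ⟨38034890899333120, 8590263819, 1692618180768969728, [29501359212778986, 35213184680121833,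
    1692618180773163042, 1692616016109774880, 29430722133806419, 29430722138000587]⟩,
  ⟨2314886321092436000, 2251808403949067, 1728637356720452608, [32728706623790588,
    34978032536313338, 1727986755342874678, 1728619799162566708, 19218320595458542,
    28223320826943980, 1728645775197090859, 29351832073852394, 29422063379076585,
    1728645639910280219, 71322314920379480, 107351111939343415, 179408705977271346,
    1728645775163537457, 1728645639872010288]⟩,
  ⟨9043277519005832, 2251799814014467, 1753103799243156736, [28224403310473311, 28224403310989399,
    32727865499463763, 1763956144451249166, 1763936406928968708, 19217118114467958,
    19217118148014190, 28224042524848236, 19217118156386398, 28224042533220444, 19217118156902486,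
    28224042533736532]⟩,
  ⟨27198382913095720, 2251799813702467, 1790338599465636864, [29423987562697847,
    1800054210626495536, 19219282706348142, 19219282706405483, 19219282777970767]⟩,
  ⟨2314886321092436000, 2251808403949059, 142248511493325824, [71322314920379510,
    29423987667866696, 1836721327908340768, 19218320738849870, 28223320970335308,
    19217238407098438, 28224403302101060, 137746011348223023, 107351111939343431,
    143379638375366795, 143379908958307331]⟩,
  ⟨11294528247963680, 8590263811, 1872752545137247232, [33853249857958378, 33932139817251304,
    1872754469286588450, 1872751222291441696, 32728571969829204, 32728571974023372,
    32728571974547524]⟩,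
  ⟨0, 146029217283, 107351111843005440, [71322314920379483, 106219714378023966,
    107351111939343411, 395581487856174141, 395581488061695021, 395581487994717213,
    395581488091055157, 1002467926158296103, 1008063340832048163, 1006962729692644390,
    1008071037413442596, 1728646977792721941, 1908711110854979597, 1908710629818642437]⟩,
  ⟨17870485631548817408, 15762976653050115, 1944584653353635840, [32728827227206724,
    1944584773612720131, 1944169398778038294, 1944803404670404627, 28222809532724429,
    28223906896868556, 28224042188496075]⟩,
  ⟨18160756731343273984, 4398046840323, 107351096901739520, [71322314920379477, 30129351920252104,
    102425299841165327, 35257424755881297, 107289524250555412, 35199113293643381,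
    35268382526193268, 35267420453518963, 35292554602149481, 35293516674759272, 34632933524829798,
    35266217862690404, 35266338121774691]⟩,
  ⟨8070617941491056640, 360293467748041219, 138454096860129280, [889448026082436815,
    34482685670169961, 34487886875522385]⟩,
  ⟨8647043234544492544, 5909875328513, 2052245567812808704, [35047692912883043,
    2052262885116953617, 32726391980749894, 2051612644252200965, 32726391980225742,
    32728706967598283]⟩,
  ⟨2243033785434112, 72062129523721731, 2088837538085746688, [32727624636363843,
    29430722066749813, 29986920331646323, 2083137738564579367, 23719212053361735,
    2087641321012080646, 71322314920379469, 107351111939343462, 215437487958602773,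
    214944906749359126, 215375915307447316, 215306646074897427, 143379652879255784,
    143379908958307450, 215375915008075836, 214944906449987646, 215437487659231293,
    210511675566794815, 215306645775525947]⟩,
  ⟨74162080818659328, 18014535948435456, 2122397009578545536, [35285699834395260,
    35293396415789691, 35283897021683188, 34650853202105830, 35213184680121821,
    35292315157583323]⟩,
  ⟨145373059493146880, 18014535948435456, 2158425806597509504, [35133332450964732,
    35273915320497403, 35282574276532468, 34570640531100902, 35133453045626077,
    35273915656074459]⟩,
  ⟨272708948459520, 18018933995275779, 323031297805232256, [1074648545235765446,
    323393037130770563, 318598066923086871, 71322314920379464, 323462321396208652,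
    323523894047364109, 318598081954927631, 107351111939343465, 143379892852434969,
    143379893925914681, 143379907884827672, 143379908958307384, 323031312807183409,
    323031297774790704, 323031057256614066]⟩,
  ⟨9277687942539640832, 4535485793795, 70214006964700160, [23719737574160892]⟩,
  ⟨30064771072, 4535485793795, 107351111838876672, [71322314920379486, 103410462030513215,
    105680953676284955, 103410462265394231, 107351111939343414, 390655420444379311,
    395581232536815789, 395450390653110443, 395088651327572142, 395519659885660332]⟩,
  ⟨162986136325603328, 70816628802051, 1835290304685650304, [33927449788926019,
    2303744954151832581, 34006910433196413, 34006910969936237, 34006911003367773,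
    2304460255186281494, 2305022105627558933, 34640225376762059, 34650252011346120]⟩,
  ⟨164116434278940672, 578712724050347523, 1871319011241873792, [35203158150838389,
    34640225377286214, 2339843020403912709, 2340476304742296579, 71322314920379470,
    34650853201991150, 34654701492688358, 34650251906562526]⟩,
  ⟨506390005959098368, 137439282691, 487946423404392832, [67381649979156607, 67381650113570911,
    70829717908039805, 71322314920379510, 35292555407324667, 35292555675751923, 35293517748419043,
    35292315157583323]⟩,
  ⟨0, 137439282691, 2410627385998684544, [35283896484821500, 2410629310412345780,
    34650852933563886, 34654701224261094, 35292315157576155, 2410626995156467134,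
    35292555138890235, 2410626995424901555, 70683498656384094, 71314618334397540,
    71314618338526316, 71183776447480925, 70190917426037878, 71322314920379499,
    179408705683670074, 179408450133100728, 179408585688810801, 179408705947911218,
    179408450397341872, 179408585424569657, 179408705969013786, 179408450426701992,
    179408585709913369, 179408585718170921, 179408450418444440, 179408705977271338,
    539696420616341666, 539696661134518304, 539696676166911009]⟩,
  ⟨13873339064968544256, 329219, 71191473036215296, [19219282131349979]⟩,
  ⟨0, 329219, 107220270018937856, [71322314920379507, 107351111938884637, 102425299810206775,
    102425299542295615, 106858530425488446, 106858530730099750, 107351111939343397]⟩]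

set_option maxRecDepth 100000 in
/-- Refutation of a blue path of length `7` in `K_{8,8}` without a blue path of length `9` with
the same ends. -/
def pathCert : List MaskDerivation := [
  ⟨9295429630893852808, 145137699521024, 66140230714737664, [29990407657577548,
    29993654652889156]⟩,
  ⟨9895613138944, 576605890137556482, 102169388510954496, [29986920446379084, 102169027733694468,
    71322314920379476, 102204263645197319, 102239379298002947, 30136642665048297,
    30135680592373969, 102240581586994239, 102239619468057657, 102209795221333048]⟩,
  ⟨576470647916560384, 162730020177410, 138200109331489792, [29986424036179199, 29989310254524668,
    138200109675267092, 143370288226804748]⟩,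
  ⟨9799860276957382656, 1153066642440979970, 174258730946095104, [30135680592862289,
    29986559668889672, 174059822121569287, 174060303115987971, 179399084943752249,
    29990407618518264, 174226982548882452, 29993654613923020]⟩,
  ⟨8421376, 145137834132994, 125369908482778112, [71322314920379519, 29990407618668796,
    107351111939343404, 143379908958307387, 210326972945744939, 210326972946662440,
    210296186619536400, 210326010873070603]⟩,
  ⟨19793400864768, 145135736717696, 246118378531091456, [28855853692136660, 28853343283931340]⟩,
  ⟨9799834990371045376, 2450103332976199298, 282137554823369728, [28859115719783636,
    287485476302201868, 71322314920379500, 29486010991803610, 282330931091428410,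
    287415244656827413, 29503328299998416, 29422063224048843, 29510017711819976,
    282330931094180920, 287415244649315373, 29415779644718315, 281731559812183069,
    287415244695419917]⟩,
  ⟨2882305962729965568, 4398198031874, 323446928234423296, [29419898522806509,
    29419898560531669]⟩,
  ⟨2377902804464435200, 153940369608322, 359475725253559296, [29509882407525717,
    29507717677052269, 354406564324028455, 354389487538754592]⟩,
  ⟨2882303806656380928, 13194290790914, 395501636054500352, [29417703819677013,
    29417703828064461]⟩,
  ⟨2594073945967853568, 13194290790914, 431530433073464320, [29492565099445589,
    29486973064800461]⟩,
  ⟨11529217253715247104, 8847785461250, 467562116302078976, [28853102421720301, 28853102455266533,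
    467639082128409628, 467629461401781260]⟩,
  ⟨11601273269353840640, 51673826818, 503606306495759360, [28857717393453405, 28853342969298261,
    30072950472798544]⟩,
  ⟨2201212846080, 144260323762505346, 107350149865636864, [71322314920379492, 107351111939343380,
    179407743904597090, 143379908958307418, 534555359782413351, 179408705977271395,
    215437502996235297, 224444805313418347, 534548865456141370, 534533472299603000,
    251466300015199307, 287495097034163261, 534550549079178303, 534548865456485435]⟩,
  ⟨19793400864768, 145135686386816, 570369855121404928, [28855853692136660, 28853343283931340]⟩,
  ⟨2759558594560, 180320058738306, 611623428308116480, [28859115723976933, 28859115724105956,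
    28859115723984093, 611746573618684948, 611744649473336332, 71322314920379500,
    611677304386135061, 611674418168112141]⟩,
  ⟨106113645314048, 145135686386816, 632314141198791680, [19852597204850022, 19852476945765733,
    19852476945823069, 637363098601796630, 19849756096679118]⟩,
  ⟨2155905024, 145135686649474, 683196137693135872, [19850853389551862, 29417704062830835,
    683196137726452779, 19850853460830430, 19850853460823254, 677894395736503309,
    71322314920379477, 106858530730099758, 107351111939343405, 179408705206567969,
    152387210504786983, 179408705742390321, 476646384446166041, 678665015948620841,
    678664053875946513]⟩,
  ⟨45097173184, 75046098567682, 719223972660857856, [24914106659212377, 719223972669244427]⟩,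
  ⟨148209926336, 576606712625366794, 745442273735318528, [19849755786972286, 755792492160304189]⟩,
  ⟨18014447935160512, 673449474, 791821289449014272, [24914106612878451, 24998769008217200]⟩,
  ⟨187942584512, 215779308734218, 817640571170297856, [35203803397944945, 817675205789131824,
    71322314920379510, 35202466320807389, 826531806077495357, 817640570901863481,
    817682902102615096, 24912182198901887, 24914106344508542, 107351111939343419,
    24912182500896871, 827850086499918893, 827847200282068011, 827850086499890217,
    19849756101217365, 19849756101676109]⟩,
  ⟨51319464032, 75179259463434, 66211784874476544, [19846163357590637, 863948152751404073,
    863255460420823076, 14715429790509140, 14712543572486220]⟩,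
  ⟨50512052416, 215779308733954, 102240581893440512, [33359436131961965, 899976949769414700,
    899126236998896676, 71322314920379484, 898563424484428829, 898704127617239061,
    19851935798618193, 898589400450770957, 898567994333638661, 107351111939343461,
    24914106659212363, 24998769054551112, 24912708647543875]⟩,
  ⟨2891323068284665856, 572787720, 935918919698564096, [35205968061397617, 35207892206810736]⟩,
  ⟨47257370816, 215779862384394, 971954691741743104, [35203803397944945, 971980667706623024,
    71322314920379509, 971979705664842795, 35205352572384597, 970761721315454013,
    971394765135146043, 961755758977719353, 961790393597076536, 215226808845610110,
    24999731118387303, 971980667737560105, 971954691777389608, 19849756102199373,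
    971962388356705325, 970761721650973733]⟩,
  ⟨10750144608, 75041702151426, 1007353331184405504, [33359436145330276, 14712543572486236]⟩,
  ⟨50478629056, 215779325511170, 102240581893440512, [33356549926325340, 33359436136155245,
    1044098872354098220, 1043258742387025956, 71322314920379468, 1042678612564477973,
    1042704588526626829, 1042683182409494533, 19845907810520165, 107351111939343389,
    24914106659735627, 24998769055074376, 24912708648059971]⟩,
  ⟨51016421456, 92633905366530, 281749117986882560, [14713640935777380, 33364381799648328,
    1078835124727558181, 1079987206763660316, 14715565081978965, 14713640936630349,
    14715685341056069]⟩,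
  ⟨153558773840, 92359681771010, 173662726929983488, [14713640936286308, 14713640936623189,
    33369192163543120, 14715685341127749]⟩,
  ⟨45265746710608, 72273099024510466, 1152123690726152192, [35203803397944945,
    1152109259638654000, 251323432219337843, 1152091821803521081, 24285301666081882,
    34490006518209608, 24285812768064578, 1147074733028492351, 1151569536562840638,
    1152124652533531709, 1152109259370742843, 1152100600716616762]⟩,
  ⟨72103820770934784, 1125900597595650, 1188152487477656576, [35205968061519483,
    35203803398002297, 1188138056656012341, 1188153449818801203, 1188153449818765361]⟩,
  ⟨73793770142826496, 690750978, 1224166853676581888, [35207892206746227, 35203803397930608,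
    1224166853406549053, 1224182246569337915, 35292314084038266]⟩,
  ⟨50478497856, 233371528463874, 1260211043588258816, [35292554602206842, 35203803397995129,
    1260192764475881525, 1260210081784018995, 71322314920379505, 107351111939343410,
    143379908958307384, 178161859791373387, 1260195650727457833, 1260131191858480156,
    179408705977264213, 1260192764509463597, 1260210081817536555, 1260185067929101352,
    179408705977271373, 1259018073765880869, 215437502996235357, 1260264919960036372,
    1260262995814687756, 1260261672964731908]⟩,
  ⟨36286568071360, 708910290572562, 1286014932416829440, [19853604312493174,
    1296275076788995120]⟩,
  ⟨52827565113536, 215779342419458, 67373968430154752, [431337657527387257, 35132791482275292,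
    1331691394251532339, 1322086060636021808, 19849756021602423, 19845907731098742,
    71322314920379441, 19214788132449355, 19853604388187208, 33927329592683587,
    1332320589852787755, 1332322513997935657, 1332313855344856104, 14713250080600167,
    1331599636633858084, 14712288016247892, 14712288016706636, 14713640931648580]⟩,
  ⟨210461802688, 13195096491522, 1368359007597863936, [14713250094090324, 24360914872010832,
    1368296472874428429, 1368358045525583884]⟩,
  ⟨26560077774912, 5498498582018, 1404370487310181376, [32725430244254796, 1404297850823199749]⟩,
  ⟨61826058436800, 576605888795379202, 287478741798642688, [539536610786174067,
    1440408904755004472, 1440416601635247145, 14713249782733909, 14712287710059604,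
    24357066269957200, 14713249783192653, 14712287710518348, 23718250014678091, 24357066270415944,
    1435275284921164863, 1440355028683408445, 1440416601334563900]⟩,
  ⟨576488252979019776, 18089165720389122, 1476445398355362816, [35277161439296124,
    35276199366736504, 1475745009673086004, 1475806582324241459, 1475802734029092913]⟩,
  ⟨594783130041221312, 74767210907138, 1512473233567922176, [35276199366686323, 35274034703169137,
    1511773806423680060, 1511831530783751225, 34646041765017214, 1512474195674149929,
    24357066538649684, 24919879053640779]⟩,
  ⟨3233857728, 215779308733954, 1548502992393290752, [35058530424053372, 35056486019742328,
    1548441420010046517, 1548502992661201972, 71322314920379504, 107351111939343414,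
    143379908958307387, 179408705977271336, 215437502996235307, 1547802603777991716,
    251404727364043868, 1547248449917592613, 251466300015199325, 323462321401971757,
    323523894053127212, 539696676166911057, 683811864242766937, 863955849337586720,
    1547864176429147171, 1547860328134127649]⟩,
  ⟨551910662336, 39582570382850, 1584522168985363456, [24360914862649452, 1584514472405001256,
    1584531789716866080, 14712288021401676, 1584393251238749221, 14713250094076004,
    14713250094599260]⟩,
  ⟨9281936425285083328, 4398199342594, 1620533287618956288, [24352255298681977, 24360913952750712,
    1620552890149647401, 1620543269423965224, 14715429750754524, 14713250056386636,
    14715565044024388]⟩,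
  ⟨9277415785372860608, 39582570382850, 1656579762721604608, [14712287715256396,
    1656512417592484925, 1656581686866953276, 19218891364563195, 19781703879031034,
    1656581687135323187, 1656581687135093810, 71322314920379508, 1656581687168640044,
    107351111939343444, 1656512417936090133, 1656509531718067213]⟩,
  ⟨10394360717607223488, 4398198294018, 1692520530360486912, [24349369080659057,
    24357065662053488, 1692541214955025449, 1692530632156668968, 14713249745058909,
    14713249749187669, 14713249749646413, 14712543227798597]⟩,
  ⟨36081575732990144, 4398064076290, 1728585405103490048, [14712287945406581, 23719212322240627,
    1728585405136806955, 14712288016706653, 14712288017229909]⟩,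
  ⟨9710905113337397440, 4398198298114, 1764665793302930432, [24285301321824324, 24352255835421801,
    1764666154084347940, 24982413168670817]⟩,
  ⟨2155905152, 215504430827010, 1800413544539896832, [14712543496225861, 14712287102155901,
    1800694951065601076, 71322314920379506, 1800694950797173818, 1800694950797130809,
    107351111939343436, 143379908958307452, 175406483586106412, 179408705977271341,
    287495096968102966, 283554447026242623, 283554447360214055, 283554447294153783,
    287495096700191806, 287495097034163238, 1148245575815349254, 1616619937061880862,
    1800065755570152470, 1800061907279455246]⟩,
  ⟨17637283233920, 145689720653314, 1831551645417554944, [29981749304184020, 1831551284640302097,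
    29980651931667660, 29980651932191812, 1831622838795453483, 1831621876714392601,
    1831621876722779147]⟩,
  ⟨123195239792800, 145685441676802, 1867480386873689088, [14715565076739148, 1862461614508847110,
    1867528129729900548, 29426362784516203, 19859512111237222, 28864512342722660,
    29503328606718041]⟩,
  ⟨123158197731744, 145685291009538, 1903570756547478528, [14715565077255244, 1898498108112875526,
    1903564623333928964, 29503328598983785, 19859512111760486, 28864512343245924]⟩,
  ⟨123188262510760, 145685290943746, 1939616870873999360, [14715565077255244, 1934526905131380742,
    1939593420352434180, 29416050568504425, 19218080220882022, 28223080452367460,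
    29416291095561297]⟩,
  ⟨123188262512800, 145685290943746, 1975645667892963328, [14715565077255244, 1970555702150344710,
    1975622217371398148, 29415779985622121, 19217809637999718, 28222809869485156,
    29417704139622481]⟩,
  ⟨123207623418016, 145685291469056, 2011533882042394624, [14715565077255244, 2006453657285603334,
    2011520172506656772, 29417704126254187, 19850853452975206, 28855853684460644,
    29486657691739202]⟩,
  ⟨123171082641572, 145685290943746, 2047703261930891264, [14715565077255244, 2042613296188272646,
    2047679811409326084, 29486417165198441, 19781028026819686, 28786028258305124,
    29486657692255313]⟩,
  ⟨123173297225888, 145685291074818, 2083732058949855232, [14715565077255244, 2078642093207236614,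
    2083708608428290052, 29486011286129769, 19780622147751014, 28785622379236452]⟩,
  ⟨123212144844960, 145822965501702, 971549659185177600, [1223468147629778034,
    2119046877412299835, 2119206701738271800, 423236404317867133, 19853739670998110,
    2124348018483964971, 2124348018483950633, 2124313383869826088, 2114711898574071846,
    14714347453066326, 14714347453525070]⟩,
  ⟨123280595919072, 145822965501702, 70214007199581184, [2150706060972624926, 14712288012706918]⟩,
  ⟨123194702856320, 145822881416706, 1043449473069638656, [1295806667453785214,
    2186769492545022006, 2191909846846358576, 29502366420932727, 791403509191895089,
    2197021339033511979, 2197021339033490473, 2197004983800120360, 14712423299517534,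
    14712423303710806, 14714347449059412, 14712423304234062, 14714347449582668,
    2186720787682734118, 71322314920379462, 2191801132694473764, 107351111939343452,
    143379908958307418, 251464135351674961, 179408705977271362, 215437502996235353,
    675437983681954850, 251466300015199307, 287495097034163267, 323523894053127240,
    2191264296146871317, 2191238320184722445, 359552691072091216, 2191264296143201309,
    2191101224820584453]⟩,
  ⟨18730352377992, 144260324283658498, 2227842436326669312, [29986559290555519,
    2232848100488862780]⟩,
  ⟨53032117108872, 145135686649346, 1116000610624365568, [1368339525627700341,
    2263321889848928317, 2263897209311151160, 30135680555072639, 71322314920379449,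
    30135680928360529, 30136643001034832, 30136643001558088, 2269078933072421931,
    2269071236490998825, 2269061615765316648, 28223080447650909, 28224042520325212,
    28223080451844181, 28224042524518484, 28223080452367437, 28224042525041740]⟩,
  ⟨26467769516032, 9152334943495946, 2299209984007645184, [29982019740285431,
    2305030764244124723]⟩,
  ⟨53032150663168, 145135686649354, 1188127473659962368, [1440397119430747261,
    2341120171875918888, 35202466589234653, 35272818153543132, 2335788124523378739,
    2335990400303151153, 2336025034922214448, 29418245153143287, 71322314920379445,
    30138973011881296, 29981749295754443, 30138973016075464, 2341126906383778859,
    2341128830528926761, 28855853679742293, 28856951043886420, 28855853683936461,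
    28856951048080588]⟩,
  ⟨3378260213760, 576605888006466850, 2372024007417374720, [30066275992780287,
    2377084028688483384]⟩,
  ⟨123676007628928, 145135703426570, 1259199905514284032, [1511329088674620533, 34569858440295902,
    35132791213848029, 2407437077924784189, 2408047994072644665, 2408082628692231224,
    29986423960813055, 71322314920379451, 2413131586423401515, 2413131345905232937,
    2413108496681282600, 14713250075946326, 14714347440090453, 28857356918238545,
    28866150863777104, 14713250080140494, 14714347444284621, 28224042519801035, 28866150867971272,
    14714347444808773]⟩,
  ⟨105898869555200, 5497995134474, 2449133204891330560, [14714482735754461, 14714482739947733,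
    2449205600860136460]⟩,
  ⟨54404359159808, 18159536075179530, 1332242661735818240, [1584512307506603133,
    2483934637660727349, 2485251715185223723, 2485251715185202217, 28864512233093461,
    28865609597237588, 30069568387201361, 30069703678728528, 24360914757400782, 28864512237287629,
    28865609601431756, 29990407849162955, 30069703682922696, 2474999868693586999,
    2484633823977809969, 2484635988642710576]⟩,
  ⟨124773103337600, 2396937412937218, 69710482413667328, [30065720096504145, 28860799238060236,
    28860799238584388, 2516139195758453815, 2521218939520697397, 2521280512171852852]⟩,
  ⟨164470494085513216, 286000642, 2557309308922446848, [34485961891494524, 34646041764945531]⟩,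
  ⟨123147458216064, 145685442463234, 107348947040937984, [71322314920379513, 107351111939343411,
    143379908958307382, 214821776484680798, 215375930345079901, 179408705977271336,
    215437502996235356, 287495097034163289, 359552691072091203, 431548712458863652,
    431117703900775462, 431610285110019109, 791898255299658784, 2588196789863359523,
    2588191979495665697]⟩,
  ⟨38650034895454208, 18577349688428034, 2628647272867526656, [23722624669348956,
    24927139700556880, 2628724238682044430, 34490142044861516, 2628716542099617800,
    2628723637386622982, 2628749012053665795]⟩,
  ⟨39125571526983680, 19140299641849346, 2664779011650899968, [24927139694692579,
    24912708604692705, 2664756883991741462, 2664756883991282704, 2664753035701044238,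
    2664779011663479819]⟩,
  ⟨38685805530628096, 18014674612389378, 2700739501560185856, [14715685336396884,
    2698886068403163141, 2698886188662247428, 19858414641729781, 24360914757472500,
    24922765199266027, 24919878981243112, 19858414641715429, 24360914757458148]⟩,
  ⟨9262620753684103296, 18019072659424770, 2736599574777576448, [30065314226884676,
    25006073568426622, 30070424125962876, 2736802933192156200, 2736810629776683041,
    71322314920379470, 2736837567811699747, 2736837567812158496]⟩,
  ⟨40374893762576512, 1208747522, 2773405125527700480, [14712288012054629, 14712288016247901,
    2772866364830090262, 2772829204772916230, 23721407007791459, 24284219522259298,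
    24354450827483489, 24364973497423184]⟩,
  ⟨9259524531087769728, 18018797781517826, 2809430554986560512, [14715685226583109,
    2809499944478517252, 14713248868072061, 2809503191473800252, 23719211172224635,
    24352254991916665, 2808825892579460148, 71322314920379476, 107351111939343398,
    179408705977271346, 215437502996235313, 2808895161812010035, 2808895161813386288]⟩,
  ⟨15042076083887308928, 4399272035842, 2845442034967333888, [24349368773951089,
    24357065355345520, 2845462719561872425, 2845452136763515944, 2844292839194248230,
    14712422086867557, 14712422355302877, 14712422388857173, 14712422393051341,
    14712422393575493]⟩,
  ⟨13889224398528839840, 3467776112347317762, 2881506909711713280, [19853738765048944,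
    2880918121268012072, 14712423232288861, 14714347453525070, 2881277575367900173,
    14715685259957316]⟩,
  ⟨9259524531087769728, 4399272035842, 2917535706730677248, [24357336244411632,
    2917509730801443880, 14713520595908829, 14715685259433165, 2917306252127779852,
    71322314920379461, 14713519719447037, 14713519719439861, 142333173653783580,
    107351111939343484, 143379908723426366, 143379908958307382]⟩,
  ⟨36116759570317440, 4398198294018, 2953616455672412160, [14714347372919156, 19850853381028209,
    2953616094928741417, 14714482744191180, 14714482744715332]⟩,
  ⟨36117446762987648, 4398198294018, 2989643929841707008, [19218891826058739, 19851935645750769,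
    2989645252725130283, 2989647176870278185, 14714482731610452, 14714482735804620,
    14714482736328772]⟩,
  ⟨37278447281668096, 4535639343618, 3025466242050458624, [14715565076739148, 3023144159341629446,
    3025392763733364740, 19779524644688373, 28785622240317940, 29347472682097131,
    19780622008818150, 28785622240303588]⟩,
  ⟨0, 145135686649346, 3061556611720578048, [14715429637756388, 19782110214936026,
    14714482668697804, 3061635501642138677, 71322314920379506, 3061635501679985699,
    3061635501679871010, 107351111939343461, 143379908958307413, 178916124768027677,
    179408705977271326, 503667879081886775, 503667878813975615, 503667879147947047,
    1295808832355910701, 1295254678495511596, 1296301413565154350, 2413194121153037319,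
    2881568482399568927, 3056571151118148631, 3056566340754777103]⟩,
  ⟨17298591082312892416, 1627653634, 3096486721707983872, [14715429402768726, 3096494418289378325,
    14714722041919094, 14713639710160501]⟩,
  ⟨16143558240502812672, 4508015810840066, 3133479154769082368, [35053195039256644,
    3133490819900516355, 33369972621637237, 3133682512915227688, 3133682512918897696,
    14715684957517005]⟩,
  ⟨17294087484833005568, 288234791529874946, 3169668016050682880, [35133451833636473,
    33369972621637237, 3169789237786196017, 3169781541243085856, 71322314920379468,
    3169798858513204275, 3169798858514580528, 107351111939343476, 14713249673311710,
    14714347037455837, 14714482328925660]⟩,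
  ⟨17294087482685521920, 360287972472128002, 3205740106652214272, [14715684919768541,
    3205810337957438492, 14714347075204301, 14714482366674124, 3200673831949329423]⟩,
  ⟨16249252094257659904, 135005698, 3241794879901352960, [14715684919768541, 3241856452552508444,
    14714722041854581, 14715684114593396, 28867773153533552]⟩,
  ⟨17294086451893370880, 288234791529874946, 3272143599849849856, [14715684953322837,
    3272705450291643412, 33370273269283445, 33364500833302132, 3272774719525569584,
    71322314920379511, 107351111939343416, 143379908958307423, 243092419454387237,
    251466300011529255, 247525650337580070, 238597615920038948]⟩,
  ⟨11529426152301002752, 33776997357061634, 3313852473937904640, [14713640582378845,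
    3313914046589060124, 3313275230333322262, 3313906350007665684]⟩,
  ⟨11529426152301002752, 32088147496797698, 3349862991575791616, [14713640591684685,
    3349933222881015820, 3349299577765902342, 3349932862103762948]⟩,
  ⟨11529426152301002752, 31540591108818434, 3385910068009149440, [14713640590701781,
    3385840798743282708, 3384717097817748494, 3385840798701335564]⟩,
  ⟨14989915268096983040, 31538597740414466, 3420077735393546240, [14715684991530053,
    3420077855652630532, 3416889907633366047, 14712422959150423, 14712543218234710,
    29487754937537873]⟩,
  ⟨17295212918735896576, 4398198294018, 423236404540318720, [71322314920379477, 14714722847158757,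
    14715684919768548, 106735385427788828, 29487754903983577, 107351111939343389,
    30049228462407273, 143379908958307377, 29910689997307499, 179408705977271347,
    24284488997992054, 28786989113734773, 28786027041060468]⟩,
  ⟨6917704949501526016, 67554750478418434, 3492714978230322176, [14714482405274702,
    3493840603296990220, 3487014938140659719, 3487015298917912580]⟩,
  ⟨11529426152303099904, 54043814155552258, 3524802163540395008, [14713640591225940,
    3519663132053747718, 3524729647312547844]⟩,
  ⟨5764836221454950400, 22518204312323586, 3565984783875720192, [14712422963344605,
    3565415236814914588, 14714347112821974, 14712422967473364]⟩,
  ⟨263882790666240, 288234774350005762, 3601926032281207808, [14713640591225940,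
    3600727650468509702, 3601853516053360644, 71322314920379469, 107351111939343375,
    143379908958307349, 175468056237261942, 171034825420129381, 171034825354069109,
    166540021885781092, 166540021819720820, 179408705911211127, 179408705977271399,
    359552691006030898, 359552691072091170, 571784823218324542, 575725472892273727,
    567351592335131709, 562856788800783420]⟩,
  ⟨158329674432640, 9367491625276409346, 3638163237987040256, [29986920106243140,
    29990407619716220, 3633062689445463099, 3633062689447298104, 3633019396129717288,
    3633019396173757448, 3633060524781938691]⟩,
  ⟨289549790105075840, 9367491623137314306, 3667161207587665920, [29911051656442948,
    29349802510099581, 3669060700138849339, 29349802778469493, 29911653220263028,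
    3669055889729215531, 3669055889775090699, 3669060579879478274]⟩,
  ⟨2595463187390316736, 13979177641556313602, 3710145189364057088, [35198993034508904,
    14715565076753501, 14715565077276757, 3699328605639056396, 33850363409134795,
    33999890548061384, 3709507935862913028, 35127919915744884, 3699882759462755379,
    3699986543091704880, 3709580452388576291, 3699986543090787360, 3699978846844281886,
    19779523877664887, 19776637659706486, 19779524414533735, 19776638196446310, 19779524448087130,
    3709591877014184982, 19780185877881922]⟩,
  ⟨167400645369952, 286000642, 3746259610854245376, [14715429781090404, 19218891969507427]⟩,
  ⟨289620178184994944, 13979177641556313602, 3782263273420318720, [35266338121832056,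
    3780392161944443956, 3781041440778806304, 32726392316728396, 33851581406684226,
    33851055167871094, 33850093095261301, 19215043679003749, 3781507204542798884,
    3781514901124193315, 71322314920379494, 3782288407868908587, 14715429785269340,
    14715429785785428, 3782208555534924813, 3782208074498587653, 107351111939343485,
    3781645743020456974, 3781645141725035526]⟩,
  ⟨4901306196603994256, 9367491623128925698, 3817669729979155456, [34637142592715368,
    3813114194961032224, 14715685335837790, 3811924231283711005, 14715685336361046,
    3812532261280734229, 34413416441771211, 3812527931957835781, 24284850657141826,
    33854706925681269, 3813032539004509235, 3813163381257051171, 3813094112028630028,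
    24284218721695863, 24280370431063156, 24284219258564711, 24280370967802980,
    24284219292118106]⟩,
  ⟨6054174993380573312, 4398198294018, 3854320867726157824, [34553051428077169, 34560748009471600,
    3854338305325413417, 3854328684599788584, 24280370929530332, 24282565657818586,
    24280370963084628, 24280370967278796, 24282565696091202]⟩,
  ⟨289620176029089792, 9367491623128925698, 3890364817388222464, [24282564852643444,
    30050325826565745, 3885086886416019495, 30050326665295185, 3890364817425969185,
    71322314920379492, 3890364817119788092, 107351111939343428, 143379908958307390,
    251466300015199255, 287495097034163231, 3885228671888931855, 3885227950334426119]⟩,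
  ⟨1084787534992506880, 9259400836173006338, 3920661946191201280, [14713640931992661,
    3921223796632994836, 3921292103826101263, 3915524477531702286, 3914859083679397894,
    3919362786385983492, 29494112529348221, 30056925043816060, 24990650340988534,
    29494112529405557, 30056925043873396, 30127156349040235, 30144473657177705,
    30130042567063144]⟩,
  ⟨1084506614066577408, 9259405783841113602, 3957321862917825536, [35293516674752107,
    3956057698740457505, 14714723263686743, 3956690743247782933, 3951553275121009678,
    3956057699382101004, 3941914749391851525, 3941914869650935812, 34637262851799678,
    35199113293593213, 34637262851792502, 35199113293586037, 35268382526135924, 34633625014564454,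
    35196557788116581, 35266909352425060]⟩,
  ⟨435705727596660736, 36029349074044418, 3992719540266746880, [14713640931992661,
    3993281390708540436, 3987582072139973646, 3988029796755599366, 3993096311976652804,
    29986559558472948, 24920284855702758, 29423747044119781, 29986559558587620,
    35292314658470088]⟩,
  ⟨1082253710446297088, 9259405234219517442, 1008070075332510720, [71322314920379467,
    4029336163606755377, 4029336163686441999, 107351111939343464, 4029379456960054307,
    4029379456960513056, 143379908958307431, 4029379456922436659, 4029379456923812912]⟩,
  ⟨3352067922641027072, 9223372039154042370, 4069875518145181696, [24285301590301766,
    4070508802483042308, 4060204402196074558, 19780064736950902, 28786989113784948,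
    29347877482854003, 29486415947953777, 4065408253979018279, 29352206809874019,
    29491000825592417]⟩,
  ⟨1118196745560399872, 2282096138, 4101406264672863232, [30125848531426915, 4101383896483114017,
    30146307608263264, 29486010375469399, 29486010379663567]⟩,
  ⟨433735364104945664, 9223376437200553474, 4137303257427961856, [14715565077255244,
    4131031866432811014, 4131032106950979588, 19780621241809022, 28785621473294460,
    19780622047090790, 28785622278576228, 4137435061686064151, 4137465848011641871,
    4137419909041572871, 71322314920379497, 29347020943643715, 4136710139623930885,
    29347020943119563, 29496548082046152, 4136731786259719181, 29487754132313425,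
    29496548077851984, 4136834728036615189, 107351111939343485, 143379908958307383,
    4137465847710958651, 4137465847712793656]⟩,
  ⟨211108648452096, 8678436963130278402, 4178386784270386176, [14712543567246413,
    4178387746343060492, 4176065663311269894, 4176066745643028485]⟩,
  ⟨87963346141184, 27035547969782800, 4212095663558283264, [14714347452542166,
    4214343065359175701, 4209276790672863247, 4214343065375748109]⟩,
  ⟨211108648452096, 8102257685652833794, 4250524230614270976, [14712543566263509,
    4250531927195665428, 4248773257739076622, 4248781916393145357]⟩,
  ⟨211108648452096, 13675327657474, 4286474137714197504, [14712543566787669, 4286681945407833108,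
    4285837606381039622, 4286400539154591749]⟩,
  ⟨246293055148032, 13893618250886940448, 4322640030085228544, [14713250088570069,
    24349760836236497, 4302202719618191375, 4302195023036796942]⟩,
  ⟨211108917940272, 13194290790914, 4358106495626068992, [14714723262704726, 14714723263163470]⟩,
  ⟨433735366285983744, 9223376435053069826, 1359984164964771840, [71322314920379485,
    28853343284261969, 107351111939343365, 1355490323499033620, 35283535778999496,
    143379908958307340, 179408705977271344, 215437502996235268, 35257424185587179,
    251466300015199291, 30050686872311287, 30050687677535719, 274626412707791900,
    24984051392116222, 29487513580533245, 30050326095001084, 526827991840539697,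
    24984051392173558, 29487513580590581, 30050326095058420, 24984051929028070, 29487514117445093,
    30050326631912932]⟩,
  ⟨432503893910356096, 9799832789343569410, 4425529785289729024, [30050326699013468,
    4425652930592039962, 30049229343773780, 4425665437537085457, 4425647999969519618]⟩,
  ⟨4900145110177579392, 9799837187373270530, 4466817873144865792, [24284219258040524,
    24284219258564676, 24996694202904808, 4461725020877964327, 24992845912143072]⟩,
  ⟨451679393870283200, 14411518807737370114, 4502645957067773952, [24280100384863356,
    19776638464873589, 24982413168799857, 4497753817896928295, 4502248621431276582,
    19776638464988261, 24280100653405284, 24992034504213600]⟩,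
  ⟨433735364104945664, 9799837187390047746, 4538675716230726656, [14715685336339532,
    4538795494588636165, 4538865846152944644, 29496307563820285, 30059120078288124,
    19858414680523893, 24360914796266612, 4538277418149299248, 71322314920379510,
    4538254328709727254, 4538232561815084038, 107351111939343486, 1512473233312533512,
    143379908958307343, 4533751828593984535, 4533728979367582727]⟩,
  ⟨217564787456868352, 151815682, 4568528969323561984, [35132791252185189, 35131829179446372,
    14714723262704733, 4564634499146236950, 4569698849703773204, 4569001828051204101,
    4569564760824756228, 30146307608263287, 34649769796680310, 35212582311148149,
    35282813616372340, 30144474462352858]⟩,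
  ⟨1010196118555852800, 9223376435086657026, 4610950739309380608, [30048957879417444,
    30125713240014435, 30048958684721628, 4605839247154433079, 30144473657177712,
    4605839247191133223, 71322314920379488, 1584531789700092969, 4605839246886521912]⟩,
  ⟨175921860476928, 22518513718265346, 4646902570514400256, [14713640931992661,
    4646971839746950164, 4646198333270705166, 4646318953178157062, 4646952237516017668]⟩,
  ⟨105555263758336, 10434847414807691808, 4662465675881598976, [14715685334897884,
    4676521558290386967, 4681024058406129686, 4682848148234514444]⟩,
  ⟨432609500705368112, 6940054104069375490, 4717755649562938368, [14713640931992661,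
    4718317500004731924, 4718421403849413646, 35292314658470088, 4718376547212938246,
    4718421403817100339, 4717157239673034801, 35052939594007656, 4718421403855176736,
    14714723263407198]⟩,
  ⟨1010196118555887616, 9223376435086624258, 4734532048832679936, [14714723262352605,
    4748579272587399191, 4753081772703141910, 4755055945876939788, 71322314920379460,
    107351111939343365, 29347021748229367, 29347021848868058, 1720273097218806797,
    24843318773216510, 29346780961633533, 29909593476101372, 30120287391773929,
    143379908958307363, 24843318236534006, 29346780424951029, 29909592939418868,
    24843318773388518, 29346780961805541, 29909593476273380]⟩,
  ⟨722537488450584576, 58983938, 4785891835381564416, [14715685335966812, 4780808243370427406,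
    4785311705558844429, 4785297755504988165, 4785860688278540292, 30119459767645799,
    34623042215147110, 35185974988699237, 35256326553007716, 30119460036081114]⟩,
  ⟨1010196118555885568, 4398240239106, 4827113900696285184, [29909953410487908,
    4827122559350296611, 30122120499935841, 29910419682752988, 29910419720501452,
    4821977394650372151, 71322314920379505, 1800704571818091563]⟩,
  ⟨1010196118564372544, 9223376435086624256, 143377744294782976, [24912708303279171]⟩,
  ⟨1010196118564372480, 9223376435086626306, 4898530153034558464, [35132791624733928,
    4898537849619099681, 4898565388949996576, 14715685334840542, 4898450301005680660,
    4897257330843439117, 4898327155703427084, 71322314920379462, 29487513614144885,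
    30050326128612724, 24984051962582374, 30050326665467236]⟩,
  ⟨1028166536600223744, 4398068272130, 4934594185964172288, [34628213355757161,
    4934593223895691299, 34625582688352865, 24842912324318686]⟩,
  ⟨1010196118555885568, 4398236175874, 4970591234586002432, [35293516674759272,
    4970596044951474209, 4970622982987924512, 14715685335837790, 4969957228695750685,
    4970538320591080460, 4969952899368701957, 4970515832142254084, 34623042215147110,
    35185974988699237, 35256326553007716, 30119460036081114, 30137047964906696,
    4970596044914645041, 4970622020878478384, 71322314920379510, 1940879110219998251]⟩,
  ⟨3170798039801565184, 9223376436680068610, 5007187173444504576, [14715685336361029,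
    5007257525008813060, 14715685334919388, 5007205933861545997, 33369973502465224,
    4997023356369527864, 28221982751713515, 28786719373783271, 19776773483369830,
    28786719407336666]⟩,
  ⟨289620176029089792, 9223376435053069826, 927639562818372608, [71322314920379517,
    14713520671509726, 14714482744184029, 106304376869693452, 106858530730099733,
    107351111939343382, 179408705977271377, 251466300015199255, 323523894053127243,
    467639082128983055, 539696676166911035, 683811864242766937, 936013443375514655,
    1188215022508262457]⟩,
  ⟨11823338821724930048, 4398198294018, 62948433592534016, [28786267559214693]⟩,
  ⟨0, 4398198294018, 94482427612972032, [71322314920379508, 98977231382201405, 107351111939343423,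
    1548502992463021106, 1548502991927198754, 1548502992697902138, 2080561067425219629,
    2076066263890871340, 2084994298308412462, 2088934947982361647]⟩,
  ⟨289361241040764992, 284693366274, 5146272163937338368, [24848249396196479, 34632528565863547,
    24848249664623735, 34632528834118768, 5150766968078156846, 34632528867722347,
    5150766968082285603, 5150766968082744352, 5150732333464842248, 5150764803418761219]⟩,
  ⟨4964982210624, 283623818882, 5182300961562772480, [24848385069778015, 5186758965821278234,
    24847783766077507, 24844536770737263, 5186772675352937518, 24844536770823275,
    5186772675357066275, 5177061754300695567, 5186768827066175499, 5186772555097867266]⟩,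
  ⟨289361242127097952, 146180671106, 5222193321807283200, [30130042566991480, 5222098197100277811,
    5222193322075194416, 5223352740001525803, 5217650775481228351, 19781704181521534,
    19776893818472573, 19781704449955958, 19781704483509358, 19776894120331373, 19781704491895898,
    5223363202558624789, 19782230626550850]⟩,
  ⟨289361277015351392, 146189059714, 5258222119094158336, [30134642477037168, 5259381537020031019,
    19860594452170832, 5253686066486636607, 19776893818995837, 5253686066755063863,
    19781704450414710, 19776894087365749, 19781704483968110, 19776894120854637,
    5254304920053573664, 19781704492354650, 19782230626020418]⟩,
  ⟨289361279158607968, 146179917314, 5294250916113122304, [30134371894154864, 5294155791138148395,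
    5294250916112663592, 5289653290858573887, 19776893814279293, 5289653291127001143,
    19781704445827190, 19776894082649205, 19781704479380590, 19776894116138093, 19215043687189579,
    19782230626034754]⟩,
  ⟨289361280232333408, 2252223028168194, 5326415187564778496, [30134642477037163,
    30145706312777321, 33999214426691674, 33997290285930568, 5325682087873409087,
    33999213822974077, 5326416149605139511, 5321209412278997046, 5326415187532142641,
    5326385363280938032]⟩,
  ⟨3382668997689344, 4611686304202884738, 5362444946658509824, [30134762736171631,
    5362414160332932139, 30129351077256808, 5357207422703956031, 5357238209029533755,
    5357297135991400504]⟩,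
  ⟨4937357020364931168, 148319241986, 5398442957050954752, [30134762736107131, 30129832113723000,
    5397801254871805999, 33851054899436653, 5398434298695676971, 33989593402096745]⟩,
  ⟨289361242118701120, 421058578050, 3921253380369105920, [71322314920379473, 5439549333390501936,
    5433830051857223735, 33851054631066741, 33851054971001931, 33997290017496136,
    33850483740566595, 107351111939343422, 143379908958307379, 5434448905148386336,
    179408705977271391, 5433765833549186069, 215437502996235343, 5434465260383512611,
    5433849533871958045, 251466300015199319, 5439533218713448461, 5439532737677111301]⟩,
  ⟨9533562513149411328, 151782402, 5475632247033443328, [29910419414310508, 5475640905687512107,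
    30119324476161641, 24285301283551708, 24285301317106004, 24285301321300172,
    24848249127237835]⟩,
  ⟨289361345197916224, 36029080646977154, 5511645530631652352, [34623402992335465,
    35292314083916392, 5511645530635322400, 34553502936398300, 34625102188813785,
    34553502969952596, 34623869570840779, 34624966935509058, 5501322610779811902,
    5506529348106011707, 5506523816187804729, 71322314920379519, 5501322611048239158,
    5506529348374381619, 5506523816456239153]⟩,
  ⟨325390262475964480, 1383122863746, 5547464475247470592, [30119324476111481, 30129832113723000,
    5542449431215498287, 5547691765217838123, 5547464475548411945, 5547464475552081952,
    19781704340526557, 24285301820413404, 24285301853967700, 19781704378275021, 24848249664099531,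
    24848249664623683, 5537441121387161646]⟩,
  ⟨4937072982368469056, 283628013058, 5583728258515420160, [30064290912657020, 30134642476965499,
    5573380205119713327, 24996693359852142, 5583493272571045920, 19781703803657693,
    24285301283544540, 24285301317098836, 19781703841406157, 24848249127754819]⟩,
  ⟨289361448277131328, 283628013186, 5619106694401028096, [24997506024006728, 5619118119011189762,
    5614615739162903615, 30127021057620603, 5609498715124148280, 71322314920379518,
    107351111939343400, 143379908958307383, 5614609245478332451]⟩,
  ⟨289361310846566400, 141021107979904, 5655775871317456896, [24284850992009284,
    5655778035402523650, 24280100380209532, 24843874967351675, 24280100648636788,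
    24982413700878705, 5645431305171211310, 24843439405631691, 5650621687257453611,
    24982413801402713, 5650639004565648425]⟩,
  ⟨4900062187256545280, 402916866, 5691806953293693952, [24842912894792043, 24992034159309160,
    24285301585526100]⟩,
  ⟨289361241040748544, 283619624578, 5727835750279627776, [30134642477087347, 30129832113651312,
    30056655299605844, 5717488898907151423, 5727193085457920059, 5727225555413903416,
    71322314920379518, 24843439405574347, 24992966544500936, 24843439406098499,
    5727842484824395811, 5727816148085460000, 24282024894502236, 24280491599636684,
    24280491600160836, 107351111939343407, 143379908958307351, 323462321401971748,
    323523894053127205, 575725473185874966, 611754270204838942, 5727200782350692366,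
    5727200181055270918]⟩,
  ⟨291334250232283136, 36028799318230658, 5758761713564337152, [35293396415739515,
    5757497549420149817, 33370274451855605, 33291384526116077, 33287536235612396,
    5753628093774251030, 5758130593889993749, 5758692444331787284, 5757951888890412045,
    5758514701404879884, 30145706312777343, 34649288760278654, 35212221533830781,
    35282573098139260]⟩,
  ⟨289361726372052992, 36028799318230658, 5794789548510239744, [28867774370656335,
    5799891419902131212, 5799820707560569861, 5799891059124878340, 29495630800344701,
    30058578606282364, 30130313150002811, 30145706312791673, 5794754192641504303,
    5794736875334356008, 71322314920379497, 5794790510851671091, 5794754192607950897,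
    5794790510853047344]⟩,
  ⟨4937217055968460800, 2282489472, 5830765672320289792, [24983374666389105, 24997775691660912,
    5830765672353319977, 24997775691603560]⟩,
  ⟨37300811713216512, 6989586632568211074, 5871897061980193792, [30125713240028779,
    5856567635931472937, 5866847142854348835, 19780622147097807, 5866848104623064127,
    5866794469071342649, 19781704378267894, 19781704378396917, 19781704378339565,
    5871342908157412382, 5871897062017811485, 5861560793723128846, 5866055597257477133]⟩,
  ⟨974049126184386560, 6931162971977287170, 5907769040538876928, [30145706312791673,
    30130313150002803, 5906645339655239729, 5907987431918224432, 30130914445474411]⟩,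
  ⟨289361722077085696, 10889201282, 5938765236270708736, [30146668385523313, 30129832113722987,
    5943798799630586921, 5938904736892276771, 14714723267872855, 5943939262891115541,
    28788884411363407, 5942673175209813006, 5943798800238748684, 5941477799303828485,
    5941477919562912772, 71322314920379515, 24992965328353910, 29496547775855221,
    30059480549407348, 24992965328361070, 29496547775862381, 30059480549414508,
    107351111939343416, 142887327749063805, 143379908958307454, 179408705947911215,
    179408705977271351, 5938852063413881888]⟩,
  ⟨10665795436238864384, 8741717634, 5979983453341238272, [29909953410416243, 5974897215667972131,
    28785622005380439, 5978798179806495765, 24285300746861174, 28788883194362485,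
    24282024491939294, 28785621971826141]⟩,
  ⟨289361724224569344, 144115196817573506, 6010276613593847808, [28786719444868309,
    6010839426108315668, 6010910619218166799, 6010785549460125708, 35256326552936059,
    35116435173259893, 30049228462349940, 6010909657413539891, 6010926974721734705,
    71322314891019383, 30050326631805401, 6010926974755288105, 71322314920379503,
    322477158678873148, 6010926974453300287]⟩,
  ⟨468942484488060928, 8741717634, 6052102620063810560, [30120286548785771, 6046954809705900067,
    30049920522451287, 6051971778180105236, 29486972146154093, 30049919952091756,
    29486972682959325, 30049920488896988]⟩,
  ⟨434035464240889856, 36028797170747010, 6082928528026649600, [14715685339105500,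
    30049921126419799, 6077782401291568150, 6082284901407310869, 6082846751849104404,
    30049921130613967, 6082211062329522189, 6082773874843990028, 24984051660607990,
    29487513849025013, 30050326363492852]⟩,
  ⟨435174558253711360, 8775272066, 6124160214102656000, [35293396415667816, 6117732846668084256,
    14714723266366685, 14715685339105500, 6112614620107306006, 6117117120223048725,
    6118925817198760980, 6117732846738732045, 6118802671896507404, 34624966360424062,
    35187899133976189, 35258250698284668, 30119459767703151, 35256326553065068]⟩,
  ⟨289360691284934656, 8741717634, 6154986122064577536, [14715685339105500, 28788884410380503,
    6148643416857835542, 6153145916973578261, 6154954614184171540, 6153761643489261581,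
    6154831468881917964, 24982412593714814, 29486010073601661, 30048957879539324,
    30048957879481972, 6155024845522949167, 71322314920379499, 6155024845489395763,
    107351111939343449, 143379908958307447, 179408705742390321, 179408705977271353,
    251466300015199263, 467146500919739429, 466592347059340324, 467639082128983078,
    6155042162835337255]⟩,
  ⟨436011378944245760, 1208747522, 6195602081328088064, [34628348647176830, 35292178792446584,
    6195602081629029422, 35292178792561256]⟩,
  ⟨290207598706163712, 4611686019652912642, 6231630878647075840, [34648191396148846,
    35293261124205163, 6231630878345217083, 6231630878347052088]⟩,
  ⟨1766116334501888, 8800388777474, 6263164872128021504, [24983375773488495, 24983375773552999]⟩,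
  ⟨434041036927401984, 18014399735006850, 6299162882829206528, [24987900219617767,
    6299162882829665311, 6299156388839106585, 71322314920379479, 6303665382945408022,
    6303688472685003822, 34625101651893867, 34650250832952928, 107351111939343422,
    6303688472689132582, 143379908958307427, 6303688472651514931, 6303688472652891184]⟩,
  ⟨562976801161216, 20266198474966658, 6329909179273852928, [24983375840516471,
    6339682635053974554, 6329913027564808215]⟩,
  ⟨6623917522944, 56294995493914242, 6375746066685772800, [25000663134267616, 6365930279706218504,
    24982413801402727, 24983375874141542, 6371251263155094559, 6371197627603179545,
    6371220476829516823]⟩,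
  ⟨37724545674657792, 20266198458173058, 3380807475038080000, [34650251944440008,
    6407249273849857072, 24983375739927007, 24983375773481303]⟩,
  ⟨468943939475357696, 20266473201862274, 6447803660690670592, [24988847528269294,
    30146668385401448, 6437987873744146471, 34649289972296904]⟩,
  ⟨434041038001143808, 20266198474950274, 6483832457173812224, [24987899414313598,
    30146668385516152, 6483832457709634606, 30146668385401448, 6474016670755770407,
    71322314920379482, 6483832457742664736, 107351111939343462, 143379908958307383,
    179408705977271310, 6483809368002151446]⟩,
  ⟨472321626243858432, 549907613314, 6510079140365421568, [34623868996351598, 35292314083916392,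
    6515366451268568099, 6515366451269026848, 24983375739927007, 6510053164406419494]⟩,
  ⟨468940086889676800, 18023194754303618, 6555890051480110080, [24988847259827710,
    30151944752717432, 6555890051748021296, 6546081961421190191, 24988847528269294]⟩,
  ⟨436292837814829056, 18014398661281410, 6591884213918295040, [24987899414313598,
    6591884214220268590, 71322314920379482, 30120557131725435, 30120557131840107,
    107351111939343399, 6582110758406600759]⟩,
  ⟨435164712041185280, 70643845170690, 6627947645856539648, [35292314083916392,
    6627924556115624995, 6627947645860209696]⟩,
  ⟨471195751037290496, 4629770785681311234, 6654340322631173120, [35292178792446584,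
    6654340322899084336, 30121038168177263, 24912708604578007]⟩,
  ⟨867231043267078144, 2368929000686093954, 1605127256211772416, [29416291085625583,
    6694863923484967959, 35293516674823776]⟩,
  ⟨436292837814847488, 18014398661265026, 1641156053230858240, [19219282819049703,
    6731539233346110495, 71322314920379504, 35186802612813053, 35186802881247477,
    35186802881254637, 6721215471982123029, 6721215471986251789, 98484649838986341,
    6726279821969258555, 107351111939343479, 287495096971772963, 34623870179117265,
    143379908958307350, 34623869570948350, 34623870107817198, 34623870107824358,
    34622908102249690, 34623870174923993]⟩,
  ⟨867510284858687488, 71193596798080, 6757182696387620864, [35188034425517677,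
    6766758205727584293]⟩,
  ⟨651902651721580544, 2333040803716268160, 1713213647268664320, [35293516674881120]⟩,
  ⟨292177649751736320, 18014398661266560, 1749242444283621376, [71322314920379512,
    33990555508115709, 33990555776485621, 33990555809974509, 33990555809917157,
    107351111939343373, 6834304640681111611, 24983375580727550, 24982413809718511,
    24983375882586350, 24982413809725671, 24983375882528998, 24983375890843866]⟩,
  ⟨876515852035297280, 140737572635264, 6874975438663988224, [35190319348047469,
    28859115682044109]⟩,
  ⟨436293387583275008, 54043195545620096, 6896258546585105408, [35290374906175088,
    6896265281093474344, 14715685339040998, 14715565079956709, 14715685339155684,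
    6896258546852099101, 6910366381424366605, 71322314920379509, 6911567048197362708,
    24349760530385148, 24349760798755060, 24349760832243948, 179345929931539468,
    30121519204392575, 6906423807336641595, 30120557131847279, 6906423807605061675,
    24983375509434622, 24983375777747182, 24983375878271194, 24982413805596889]⟩,
  ⟨436292837827461120, 36029346926700162, 6947666076524769280, [24982413503601881,
    25000662522063048, 6947712015187854399, 35216295310260856, 6947712015455765552,
    6952745579723958317, 35188395202698859, 35187312870947427, 6952745579422099517,
    35187072352778875, 6946971460017207349, 6946971460054954021]⟩,
  ⟨445300037074837504, 54043745301432960, 6968314216477333504, [35292314083916392,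
    6968306519895423008, 35187312870947453, 33356549313718524, 33990555705185518,
    35187312871062125, 33990555705192678, 33356549884119268, 6983694873544765475,
    33989593699618010]⟩,
  ⟨436292837897695232, 31525747298402432, 7004352634223456256, [35292178792568432,
    34624967434098158, 7017837045898661931, 7004343013496311848, 34623043288814054,
    7017837045898597411, 33291384228314365, 33287535937939708, 24285301967072495,
    33291384530302189, 33287536239798508, 33291384534495461, 33287536243927268]⟩,
  ⟨436328056562429952, 31525747164184704, 7040373734661599232, [35292178792446584,
    7040373734661140528, 14714482744076526, 14713520671516908, 7040373735196446749,
    7040365076542378012, 33361615495820542, 35190199088970365, 35116436016305404,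
    35186801769903717, 35116436284560612]⟩,
  ⟨868647473296486400, 3481318246085296256, 7076393873026494464, [35293261124205176,
    7076409266188709936, 34625101651965550, 33356805468162284, 14714482748262629]⟩,
  ⟨436292837814845440, 54043195680231042, 7112439025279301632, [14714723262359790,
    7112429404554121260, 35293516674759264, 7127856000554714143, 35290374906182264,
    35290374906175088, 7112429404553203752, 71322314920379494, 107351111410854013,
    862909114267943964, 7127601291233720379, 107289538759698556, 7127038479256107051,
    107351111939343469, 7127810061620621347, 143379908958307418, 7127678257626494988,
    179347133326108788, 7127115445111969813, 179408705977271413, 215375930345072660,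
    215437502996235277, 251466300015199335, 323523894053127249, 1413395106919294999,
    1413395106919302159, 7122542713691002902]⟩,
  ⟨472330430926831616, 275063246466, 71322314857989120, [7163831162058133539, 30120557131840103]⟩,
  ⟨472321634833842176, 151785090, 4174663563335648256, [71322314920379499, 24983375777732846,
    24983375777675494, 24983375844710618, 24982413772036313]⟩,
  ⟨1623127677995057152, 34511521282, 7241052921686410240, [30152200303271528, 7235911605322728480,
    30049920757503455, 7241052921693750300, 30049920791057751, 7241045225112355860,
    30055737485344364, 30055496967118436]⟩,
  ⟨434041036927401984, 18014398661265026, 826880317014098944, [7277081718406726684,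
    71322314920379516, 30125968790511227, 30121038168177251, 1125164730800620591,
    107351111939343439, 179408705977271351, 575725473185875019, 719840661261730830,
    827927052318622771, 1008071037413442590]⟩,
  ⟨452090757247926272, 151783042, 71322314857989120, [33990554593655398]⟩,
  ⟨289360691284934656, 151783042, 106858530700739584, [71322314920379501, 106858530667709477,
    107351111939343414, 1224243819523556393, 1224243819222615097, 1224243819490526257,
    1224243819527226401]⟩,
  ⟨289356277136490608, 20266198474966530, 7385029570998518784, [34553503586961500,
    33989593708285013, 33990555206666365, 34553503012604028, 7384525445185288241,
    7384517748603929626, 7384529293476243473]⟩,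
  ⟨298367893773500656, 56294995493914114, 7420417627838654464, [14715685341127764,
    33990555777009745, 7419854814791525389, 35213664642784893, 7410848852416044089,
    35123170793855084, 7420581180202697768, 7410848852952920097, 7420581180235727904,
    19776773257357438, 19776894053296239, 19776773794211950, 19776894086842471,
    19776773827758182]⟩,
  ⟨20684226608, 11258999220213250, 7457216083080654848, [33287536244451428, 35116436398245985,
    7457138155156325402, 7457148737955964945, 14715685341185101]⟩,
  ⟨289360692362887408, 56294995493914114, 7493192928101024768, [35283895948016232,
    7493166952170049569, 7493192928134054944, 35132791022085192, 7493037071785714748,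
    7491912408758131769, 7493192927565202488, 33287415910540397, 33287536203170918,
    33287415944086629, 7491912408829453325, 33287535632246910, 33287415373162621,
    7493254500788880436, 7493253538715883569, 71322314920379484, 14714723268388940,
    7493177534974936085, 107351111939343477, 7488143970742977567, 7488113184417399831]⟩,
  ⟨325385366209052912, 2251799965468162, 7529273676812401664, [33289204189294716,
    34552540902125689, 7529221725156688949, 7529283297807844404, 7529282335734847537,
    19780622114068573, 24284219593955420, 24284219598542924]⟩,
  ⟨289360691284934896, 20266198474950146, 4534951533495798784, [24982413772560473,
    7564661733693509665, 24990110358542408, 7564696368311583776, 71322314920379494,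
    107351111939343415, 215437502996235278, 7564696368315253790, 7564673278571070486]⟩,
  ⟨4959589108969111792, 52982868346370, 7599460039792624640, [33290301591386189,
    7599461001865298956, 7601279318926246973, 34413040364330107, 34562162165716078,
    7601340891880178728, 7601340891883389987, 7601340891883848736, 24280370733050974,
    19781703875419229, 24285301355306076]⟩,
  ⟨4968600704122880240, 151782914, 7630994033277240320, [33290301591379021, 7630994995349914636,
    71322314920379487, 24285301053504623, 33291383616762989, 33287535326001260, 33291383885197413,
    33287535594371172]⟩,
  ⟨334392289512128624, 13979173243509801986, 7673181057178049536, [14713640898446421,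
    7673180095105375252, 19776893517022333, 24280490996909180, 19776894087251045,
    24280491567137892, 7668252358880148495, 7672755821068565518]⟩,
  ⟨437975063761780880, 13837309855251826178, 2629365941164657664, [30058579219637320,
    7708810594051828792, 30049920560852057, 29909457955120203, 7708788466378556475,
    7699183132798305311, 7699078266876519439]⟩,
  ⟨49539595913674864, 123626355425794, 7743568493359760384, [14713640897464413,
    7743559834705691676, 14715685303108685, 14714723230111820]⟩,
  ⟨289360691284934896, 2251799965468162, 7779595366233375744, [14713640897464413,
    7779587669651981340, 71322314920379470, 24280371274098798, 19776894053238893,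
    24280491533125740, 24280371307645030, 19776894086727781, 24280491566614628,
    103410462265394199, 107351111939343382, 143379908958307385, 175468056303322239,
    179408705977271422, 247525650341250103, 250419564945556532, 250973718805955637,
    251466300015199286]⟩,
  ⟨615871698629034128, 8070575258233210370, 7815633782768128000, [30122120499943009,
    7815633782768049209, 24284219565003894, 28786719680746613, 29910420526371956,
    7812403143948059695, 14714482750213215, 7817452101342807069, 7816813285082940438,
    7817375135524733973, 7815624162884420622, 7815632821538489357, 7815633783611163660]⟩,
  ⟨219560394618830928, 8070715445982528514, 7851654884009947136, [14713640936752221,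
    7851646225355878428, 7848260692017328151, 7853325042574864405, 7848396344281149455,
    7852899806469566478, 35290374906296929]⟩,
  ⟨904110870873768176, 151782914, 7887683681028774912, [14713640936752221, 7887675022374706204,
    7884289488734297111, 7889353839291833365, 7884425140993932303, 7888928603182349326,
    71322314920379513, 30127637385312895, 30134371894083183, 30127156348975719,
    107351111410861112, 107351111939343400, 24843874703743102, 29347472183629949,
    29910419989567612, 24843875240482926, 29347472720369773, 29910420526307436, 24843875240425574,
    29347472720312421, 29910420526250084]⟩,
  ⟨576460803843031120, 4728780639666177538, 7915207635450488832, [29911051689322562,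
    7920489534704010303, 14713640936680543, 7924984338238358558, 7915348218328400919,
    7924353218559886357, 7924915069001679892, 7910209787835237391, 7910211711980585997]⟩,
  ⟨868082039495065648, 4656723047792510466, 7950751667729657856, [33287535900731516,
    33287536169044086, 7946247244005413934, 7955254168382247980, 35293396415739497,
    35293516674809441, 7946247243468545081, 7956518331990885424, 7956518332027585568,
    7951384712237040662, 7955887212352783381]⟩,
  ⟨649657494074818672, 9008230202869250, 7996878380175380480, [33290302128240758,
    28784073981207668, 7987308643317624879, 14715565076739182, 7996315567694451757,
    35291081428295273, 35290374906246753, 7996315567660898353, 7996403116284331056,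
    7996403116324701213, 7987308643334390799, 7996315567711224845, 7996878380225692684]⟩,
  ⟨2151678064, 4657285995598447618, 8031790210182084608, [14713640630298749, 8031805603345045564,
    14714723268453470, 14715565082093660, 8027841864564119575, 8027839940418770965,
    8033468065563449364, 8028540329338222607, 8033606604041107469]⟩,
  ⟨651337513486516336, 45037035807573506, 8063316507622167552, [14713640932164717,
    8063325166276351020, 35293396415796841, 8069715253130380320, 14714723268381789,
    14715685341185116, 8063870661583097879, 8063868737437749269, 8064569126394933263,
    8069072588583350286, 8069635401097818125, 8069705632403042316]⟩,
  ⟨1688904097988688, 45318231460414464, 8099861697258727424, [14713640936630349,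
    8105472505096185868, 35257154517387331]⟩,
  ⟨0, 151782914, 8136031197406308352, [14713640936630349, 8141642005243766796, 71322314920379473,
    8141711274517152797, 8136015804243526679, 8141642005243773972, 35290374906246768,
    35293516674873952, 107351111939343393, 143379908958307377, 179408705977271318,
    215437502996235295, 251466300015199288, 274626412880282724, 283554447125333118,
    279121216414631013, 279121216477021301, 287495096971773031, 283554447297823846,
    287495097034163319, 395581487856174139, 395581488028664867, 395581488061695019,
    395581488091055155, 819553171761480709, 815058368227132420, 823986402644673542,
    827927052318622727, 3061712467490718754, 3061712467465028658, 3061712467200787514,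
    3061712467494388778]⟩]

theorem refuted_of_any {N K b b' : ℕ} {fix : Bool} (hN : 4 ≤ N) {ds : List MaskDerivation}
    (hb' : Refuted (BlueFree N K fix) (0, b'))
    (h : verify N fix [(0, b')] ds = true)
    (hds : ds.any (fun d => Nat.beq d.red 0 && Nat.beq d.blue b) = true) :
    Refuted (RedFree N ∩ BlueFree N K fix) (0, b) := by
  obtain ⟨d, hd, hdb⟩ := List.any_eq_true.1 hds
  simp only [Bool.and_eq_true, Nat.beq_eq] at hdb
  rw [← hdb.1, ← hdb.2]
  refine refuted_of_verify hN ds (fun m hm => ?_) h d hd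
  rw [List.mem_singleton.1 hm]
  exact hb'.mono Set.inter_subset_right

set_option maxRecDepth 100000 in
theorem verify_fiveCert : verify 5 false [(0, 771)] fiveCert = true := by decide +kernel

set_option maxRecDepth 100000 in
theorem verify_sixCert : verify 6 false [(0, 329219)] sixCert = true := by decide +kernel

set_option maxRecDepth 100000 in
theorem verify_eightCert : verify 8 false [(0, 151782915)] eightCert = true := by decide +kernel

set_option maxRecDepth 100000 in
theorem verify_pathCert : verify 8 true [(0, 73417885186)] pathCert = true := by decide +kernel

/-- `K_{5,5}` has a red cycle of length `8` or a blue cycle of length `4`. -/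
theorem refuted_five : Refuted (RedFree 5 ∩ BlueFree 5 2 false) (0, 0) :=
  refuted_of_any (by norm_num)
    (refuted_blueCycle (by norm_num) (by norm_num) (by norm_num) (by decide)) verify_fiveCert
    (by decide +kernel)

/-- In `K_{6,6}` a blue cycle of length `4` forces a red cycle of length `8` or a blue cycle of
length `6`. -/
theorem refuted_six : Refuted (RedFree 6 ∩ BlueFree 6 3 false) (0, 771) :=
  refuted_of_any (by norm_num)
    (refuted_blueCycle (by norm_num) (by norm_num) (by norm_num) (by decide)) verify_sixCert
    (by decide +kernel)

/-- In `K_{8,8}` a blue cycle of length `6` forces a red or a blue cycle of length `8`. -/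
theorem refuted_eight : Refuted (RedFree 8 ∩ BlueFree 8 4 false) (0, 329219) :=
  refuted_of_any (by norm_num)
    (refuted_blueCycle (by norm_num) (by norm_num) (by norm_num) (by decide)) verify_eightCert
    (by decide +kernel)

/-- In `K_{8,8}` a blue path of length `7` starting in row `0` and ending in column `0` forces a red
cycle of length `8` or a blue path of length `9` with the same ends. -/
theorem refuted_path : Refuted (RedFree 8 ∩ BlueFree 8 5 true) (0, 151782914) :=
  refuted_of_any (by norm_num)
    (refuted_blueCycle (by norm_num) (by norm_num) (by norm_num) (by decide)) verify_pathCert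
    (by decide +kernel)

/-- A cycle of length `2 * k` in the bipartite graph given by the relation `R`. -/
def BipCycle {α β : Type*} (R : α → β → Prop) (k : ℕ) : Prop :=
  ∃ (a : ℕ → α) (c : ℕ → β), Set.InjOn a (Set.Iio k) ∧ Set.InjOn c (Set.Iio k) ∧ c k = c 0 ∧
    ∀ i < k, R (a i) (c i) ∧ R (a i) (c (i + 1))

theorem exists_avoiding {α : Type*} [Fintype α] {m t : ℕ} (hc : m + t ≤ Fintype.card α)
    (a : ℕ → α) : ∃ o : ℕ → α, Set.InjOn o (Set.Iio t) ∧ ∀ i < t, ∀ j < m, o i ≠ a j := by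
  classical
  rcases Nat.eq_zero_or_pos t with rfl | ht
  · exact ⟨a, fun i hi => by simp at hi, fun i hi => by omega⟩
  have h : t ≤ ((Finset.range m).image a)ᶜ.card := by
    rw [Finset.card_compl]
    have := Finset.card_image_le (s := Finset.range m) (f := a)
    rw [Finset.card_range] at this
    omega
  let g := ((Finset.range m).image a)ᶜ.equivFin
  refine ⟨fun i => (g.symm ⟨i % t, (Nat.mod_lt i ht).trans_le h⟩).1, fun i hi j hj hij => ?_,
    fun i _ j hj hij => ?_⟩
  · have := Fin.mk.inj (g.symm.injective (Subtype.ext hij))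
    rwa [Nat.mod_eq_of_lt hi, Nat.mod_eq_of_lt hj] at this
  · have := (g.symm ⟨i % t, (Nat.mod_lt i ht).trans_le h⟩).2
    simp only at hij
    rw [hij] at this
    simp at this
    exact this j hj rfl

/-- A sequence that agrees with `a` below `m` and is injective below `m + t`. -/
theorem exists_extension {α : Type*} [Fintype α] {m t : ℕ} (hc : m + t ≤ Fintype.card α)
    {a : ℕ → α} (ha : Set.InjOn a (Set.Iio m)) :
    ∃ e : ℕ → α, Set.InjOn e (Set.Iio (m + t)) ∧ ∀ i < m, e i = a i := by
  obtain ⟨o, ho, hoa⟩ := exists_avoiding hc a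
  refine ⟨fun i => if i < m then a i else o (i - m), fun i hi j hj hij => ?_,
    fun i hi => if_pos hi⟩
  simp only [Set.mem_Iio] at hi hj
  simp only at hij
  split_ifs at hij with h1 h2 h2
  · exact ha h1 h2 hij
  · exact absurd hij.symm (hoa _ (by omega) _ h1)
  · exact absurd hij (hoa _ (by omega) _ h2)
  · have := ho (Set.mem_Iio.2 (by omega : i - m < t)) (Set.mem_Iio.2 (by omega : j - m < t)) hij
    omega

section Upper

variable {α β : Type*} {R : α → β → Prop}

theorem bipCycle_of_not_redFree {N : ℕ} {e : ℕ → α} {e' : ℕ → β} (he : Set.InjOn e (Set.Iio N))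
    (he' : Set.InjOn e' (Set.Iio N)) (h : (fun i j => R (e i) (e' j)) ∉ RedFree N) :
    BipCycle R 4 := by
  by_contra hcon
  exact h fun a c ha hc hA hC h0 h1 =>
    hcon ⟨e ∘ a, e' ∘ c, he.comp ha hA, he'.comp hc hC, by simp [h0], h1⟩

theorem bipCycle_of_not_blueFree {N K : ℕ} {e : ℕ → α} {e' : ℕ → β}
    (he : Set.InjOn e (Set.Iio N)) (he' : Set.InjOn e' (Set.Iio N))
    (h : (fun i j => R (e i) (e' j)) ∉ BlueFree N K false) :
    BipCycle (fun x y => ¬ R x y) K := by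
  by_contra hcon
  exact h fun a c ha hc hA hC h0 _ h1 => hcon ⟨e ∘ a, e' ∘ c, he.comp ha hA, he'.comp hc hC,
    by simp [h0], fun i hi => ⟨(h1 i hi).1 (by simp), (h1 i hi).2⟩⟩

theorem bipCycle_or_of_refuted {N K b : ℕ} {e : ℕ → α} {e' : ℕ → β}
    (he : Set.InjOn e (Set.Iio N)) (he' : Set.InjOn e' (Set.Iio N))
    (h : Refuted (RedFree N ∩ BlueFree N K false) (0, b))
    (hb : ∀ i < 8, ∀ j < 8, b.testBit (8 * i + j) = true → ¬ R (e i) (e' j)) :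
    BipCycle R 4 ∨ BipCycle (fun x y => ¬ R x y) K := by
  by_contra! hcon
  refine h (fun i j => R (e i) (e' j)) ⟨?_, ?_⟩ fun i hi j hj => ⟨by simp, hb i hi j hj⟩
  · by_contra hn
    exact hcon.1 (bipCycle_of_not_redFree he he' hn)
  · by_contra hn
    exact hcon.2 (bipCycle_of_not_blueFree he he' hn)

variable [Fintype α] [Fintype β]

/-- If the blue cycle of length `2 * m` forces a longer one on `N` rows and columns, then it does so
in every larger array. -/
theorem bipCycle_or_extend {N K m b : ℕ} (hm : m ≤ N) (hm0 : 0 < m)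
    (hα : N ≤ Fintype.card α) (hβ : N ≤ Fintype.card β)
    (h : Refuted (RedFree N ∩ BlueFree N K false) (0, b))
    (hb : ∀ i < 8, ∀ j < 8, b.testBit (8 * i + j) = true →
      i < m ∧ (j = i ∨ j = (i + 1) % m))
    (hcyc : BipCycle (fun x y => ¬ R x y) m) :
    BipCycle R 4 ∨ BipCycle (fun x y => ¬ R x y) K := by
  obtain ⟨a, c, ha, hc, h0, hac⟩ := hcyc
  obtain ⟨t, rfl⟩ := Nat.exists_eq_add_of_le hm
  obtain ⟨e, he, hea⟩ := exists_extension hα ha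
  obtain ⟨e', he', hec⟩ := exists_extension hβ hc
  refine bipCycle_or_of_refuted he he' h fun i hi j hj hij => ?_
  obtain ⟨him, rfl | rfl⟩ := hb i hi j hj hij
  · rw [hea _ him, hec _ him]
    exact (hac _ him).1
  · rw [hea _ him, hec _ (Nat.mod_lt _ hm0)]
    rcases Nat.lt_or_ge (i + 1) m with hlt | hge
    · rw [Nat.mod_eq_of_lt hlt]
      exact (hac _ him).2
    · obtain rfl : i + 1 = m := by omega
      rw [Nat.mod_self, ← h0]
      exact (hac _ him).2

theorem bipCycle_or_two (hα : 5 ≤ Fintype.card α) (hβ : 5 ≤ Fintype.card β) :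
    BipCycle R 4 ∨ BipCycle (fun x y => ¬ R x y) 2 := by
  have : Nonempty α := Fintype.card_pos_iff.1 (by omega)
  have : Nonempty β := Fintype.card_pos_iff.1 (by omega)
  obtain ⟨e, he, -⟩ := exists_avoiding (m := 0) (t := 5) (by omega)
    (fun _ => Classical.arbitrary α)
  obtain ⟨e', he', -⟩ := exists_avoiding (m := 0) (t := 5) (by omega)
    (fun _ => Classical.arbitrary β)
  exact bipCycle_or_of_refuted he he' refuted_five (by simp)

theorem bipCycle_or_three (hα : 6 ≤ Fintype.card α) (hβ : 6 ≤ Fintype.card β) :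
    BipCycle R 4 ∨ BipCycle (fun x y => ¬ R x y) 3 :=
  (bipCycle_or_two (by omega) (by omega)).elim Or.inl
    (bipCycle_or_extend (by norm_num) (by norm_num) hα hβ refuted_six (by decide))

theorem bipCycle_or_four (hα : 8 ≤ Fintype.card α) (hβ : 8 ≤ Fintype.card β) :
    BipCycle R 4 ∨ BipCycle (fun x y => ¬ R x y) 4 :=
  (bipCycle_or_three (by omega) (by omega)).elim Or.inl
    (bipCycle_or_extend (by norm_num) (by norm_num) hα hβ refuted_eight (by decide))

theorem testBit_path (i : ℕ) (hi : i < 8) (j : ℕ) (hj : j < 8)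
    (h : Nat.testBit 151782914 (8 * i + j) = true) :
    i < 4 ∧ (0 < j ∧ j < 4 ∧ (j = i ∨ j = i + 1) ∨ j = 0 ∧ i = 3) := by
  interval_cases i <;> interval_cases j <;> first | omega | exact absurd h (by decide)

theorem bipCycle_or_succ {m : ℕ} (hm : 4 ≤ m) (hα : m + 4 ≤ Fintype.card α)
    (hβ : m + 4 ≤ Fintype.card β) (hcyc : BipCycle (fun x y => ¬ R x y) m) :
    BipCycle R 4 ∨ BipCycle (fun x y => ¬ R x y) (m + 1) := by
  obtain ⟨a, c, ha, hc, h0, hac⟩ := hcyc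
  obtain ⟨o, ho, hoa⟩ := exists_avoiding hα a
  obtain ⟨o', ho', hoc⟩ := exists_avoiding hβ c
  have ha' {i j : ℕ} (hi : i < m) (hj : j < m) : a i = a j ↔ i = j := ha.eq_iff hi hj
  have hc' {i j : ℕ} (hi : i < m) (hj : j < m) : c i = c j ↔ i = j := hc.eq_iff hi hj
  have hO {i j : ℕ} (hi : i < 4) (hj : j < 4) : o i = o j ↔ i = j := ho.eq_iff hi hj
  have hO' {i j : ℕ} (hi : i < 4) (hj : j < 4) : o' i = o' j ↔ i = j := ho'.eq_iff hi hj
  -- the end of the path, an index below `m`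
  obtain ⟨z, hzm, hz, hz'⟩ : ∃ z < m, c z = c 4 ∧ (z = 0 ∨ z = 4 ∧ 4 < m) := by
    rcases hm.lt_or_eq with h | h
    · exact ⟨4, h, rfl, Or.inr ⟨rfl, h⟩⟩
    · exact ⟨0, by omega, by rw [← h0, h], Or.inl rfl⟩
  let e : ℕ → α := fun i => if i < 4 then a i else o (i - 4)
  let e' : ℕ → β := fun i => if i = 0 then c z else if i < 4 then c i else o' (i - 4)
  have he : Set.InjOn e (Set.Iio 8) := by
    intro i hi j hj hij
    simp only [Set.mem_Iio] at hi hj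
    simp only [e] at hij
    split_ifs at hij with h1 h2 h2
    · exact (ha' (by omega) (by omega)).1 hij
    · exact absurd hij.symm (hoa _ (by omega) _ (by omega))
    · exact absurd hij (hoa _ (by omega) _ (by omega))
    · have := (hO (by omega) (by omega)).1 hij
      omega
  have he' : Set.InjOn e' (Set.Iio 8) := by
    intro i hi j hj hij
    simp only [Set.mem_Iio] at hi hj
    simp only [e'] at hij
    split_ifs at hij
    all_goals first
      | omega
      | exact absurd hij.symm (hoc _ (by omega) _ (by omega))
      | exact absurd hij (hoc _ (by omega) _ (by omega))
      | (have := (hc' (by omega) (by omega)).1 hij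
         omega)
      | (have := (hO' (by omega) (by omega)).1 hij
         omega)
  by_contra! hcon
  refine refuted_path (fun i j => R (e i) (e' j)) ⟨?_, ?_⟩ fun i hi j hj => ⟨by simp, fun hij => ?_⟩
  · by_contra hn
    exact hcon.1 (bipCycle_of_not_redFree he he' hn)
  · intro p q hp hq hP hQ hq5 hfix hpq
    obtain ⟨hp0, hq0⟩ := hfix rfl
    refine hcon.2 ⟨fun i => if i < 5 then e (p i) else a (i - 1),
      fun i => if i = 0 then c 0 else if i < 5 then e' (q i) else c (i - 1), ?_, ?_, ?_, ?_⟩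
    · have hne {i j : ℕ} (hi : i < 5) (hj : 4 ≤ j) (hj' : j < m) : e (p i) ≠ a j := by
        have := hP (Set.mem_Iio.2 hi)
        rw [Set.mem_Iio] at this
        simp only [e]
        split_ifs
        · rw [Ne, ha' (by omega) (by omega)]
          omega
        · exact hoa _ (by omega) _ hj'
      intro i hi j hj hij
      simp only [Set.mem_Iio] at hi hj
      simp only at hij
      split_ifs at hij with h1 h2 h2
      · exact hp h1 h2 (he (hP h1) (hP h2) hij)
      · exact absurd hij (hne h1 (by omega) (by omega))
      · exact absurd hij.symm (hne h2 (by omega) (by omega))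
      · have := (ha' (by omega) (by omega)).1 hij
        omega
    · have hne {i j : ℕ} (hi : i < 5) (hi0 : i ≠ 0) (hj : j = 0 ∨ 4 ≤ j) (hj' : j < m) :
          e' (q i) ≠ c j := by
        have h8 := hQ (Set.mem_Iio.2 hi)
        have hqi : q i ≠ 0 := fun h => hi0 (hq hi (Set.mem_Iio.2 (by norm_num)) (h.trans hq0.symm))
        rw [Set.mem_Iio] at h8
        simp only [e', if_neg hqi]
        split_ifs
        · rw [Ne, hc' (by omega) (by omega)]
          omega
        · exact hoc _ (by omega) _ hj'
      intro i hi j hj hij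
      simp only [Set.mem_Iio] at hi hj
      simp only at hij
      split_ifs at hij with h1 h2 h3 h3 h4 h5 h6 h6
      all_goals first
        | omega
        | exact absurd hij (hne (by omega) (by omega) (by omega) (by omega))
        | exact absurd hij.symm (hne (by omega) (by omega) (by omega) (by omega))
        | exact hq (by simpa) (by simpa) (he' (hQ (by simpa)) (hQ (by simpa)) hij)
        | (have := (hc' (by omega) (by omega)).1 hij
           omega)
    · simp only [if_neg (by omega : ¬ m + 1 = 0), if_neg (by omega : ¬ m + 1 < 5), if_pos]
      simpa using h0
    · intro i hi
      rcases Nat.lt_or_ge i 5 with h5 | h5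
      · have h1 := hpq i h5
        refine ⟨?_, ?_⟩
        · simp only [if_pos h5]
          split_ifs with h
          · subst h
            rw [hp0]
            simpa [e] using (hac 0 (by omega)).1
          · exact h1.1 fun _ => h
        · simp only [if_pos h5, if_neg (Nat.succ_ne_zero i)]
          split_ifs with h
          · exact h1.2
          · obtain rfl : i = 4 := by omega
            have := h1.2
            rw [hq5, hq0] at this
            simpa [e', hz] using this
      · obtain ⟨j, rfl⟩ : ∃ j, i = j + 1 := ⟨i - 1, by omega⟩
        have := hac j (by omega)
        simp only [if_neg (by omega : ¬ j + 1 < 5), if_neg (by omega : ¬ j + 1 = 0),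
          if_neg (by omega : ¬ j + 1 + 1 < 5), if_neg (by omega : ¬ j + 1 + 1 = 0)]
        simpa using this
  · obtain ⟨hi4, ⟨hj0, hj4, hji⟩ | ⟨rfl, rfl⟩⟩ := testBit_path i hi j hj hij
    · simp only [e, e', if_pos hi4, if_neg hj0.ne', if_pos hj4]
      rcases hji with rfl | rfl
      · exact (hac _ (by omega)).1
      · exact (hac _ (by omega)).2
    · simpa [e, e', hz] using (hac 3 (by omega)).2

theorem bipCycle_or_of_four_le {n : ℕ} (hn : 4 ≤ n) (hα : 8 ≤ Fintype.card α)
    (hβ : 8 ≤ Fintype.card β) (hα' : n + 3 ≤ Fintype.card α) (hβ' : n + 3 ≤ Fintype.card β) :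
    BipCycle R 4 ∨ BipCycle (fun x y => ¬ R x y) n := by
  induction n, hn using Nat.le_induction with
  | base => exact bipCycle_or_four hα hβ
  | succ n hn ih =>
    exact (ih (by omega) (by omega)).elim Or.inl (bipCycle_or_succ hn (by omega) (by omega))

theorem bipCycle_or {n : ℕ} (hn : 2 ≤ n) (hα : (if n = 4 then 8 else n + 3) ≤ Fintype.card α)
    (hβ : (if n = 4 then 8 else n + 3) ≤ Fintype.card β) :
    BipCycle R 4 ∨ BipCycle (fun x y => ¬ R x y) n := by
  rcases Nat.lt_or_ge n 4 with h | h
  · rw [if_neg (by omega)] at hα hβ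
    interval_cases n
    · exact bipCycle_or_two hα hβ
    · exact bipCycle_or_three hα hβ
  · refine bipCycle_or_of_four_le h ?_ ?_ ?_ ?_ <;> split_ifs at hα hβ <;> omega

end Upper

section Graph

variable {α β : Type*}

theorem hasCycleLen_of_bipCycle {G : SimpleGraph (α ⊕ β)} {k : ℕ} (hk : 2 ≤ k)
    (h : BipCycle (fun x y => G.Adj (inl x) (inr y)) k) : HasCycleLen G (2 * k) := by
  obtain ⟨a, c, ha, hc, h0, hac⟩ := h
  rw [HasCycleLen, ← cycleGraph_isContained_iff (by omega)]
  let v : ℕ → α ⊕ β := fun i => if i % 2 = 0 then inl (a (i / 2)) else inr (c (i / 2 + 1))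
  have hstep (i : ℕ) (hi : i + 1 < 2 * k) : G.Adj (v i) (v (i + 1)) := by
    rcases Nat.mod_two_eq_zero_or_one i with h | h
    · simp only [v, if_pos h, if_neg (by omega : ¬ (i + 1) % 2 = 0),
        show (i + 1) / 2 = i / 2 by omega]
      exact (hac _ (by omega)).2
    · simp only [v, if_neg (by omega : ¬ i % 2 = 0), if_pos (by omega : (i + 1) % 2 = 0),
        show (i + 1) / 2 = i / 2 + 1 by omega]
      exact (hac _ (by omega)).1.symm
  have hlast : G.Adj (v 0) (v (2 * k - 1)) := by
    simp only [v, if_neg (by omega : ¬ (2 * k - 1) % 2 = 0), show (2 * k - 1) / 2 + 1 = k by omega,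
      h0]
    simpa using (hac 0 (by omega)).1
  have hc' {i j : ℕ} (hi : i < k) (hj : j < k) (h : c (i + 1) = c (j + 1)) : i = j := by
    have hshift {i : ℕ} (hi : i < k) : ∃ i' < k, c (i + 1) = c i' ∧
        (i + 1 = i' ∨ i + 1 = k ∧ i' = 0) := by
      rcases Nat.lt_or_ge (i + 1) k with h | h
      · exact ⟨i + 1, h, rfl, Or.inl rfl⟩
      · exact ⟨0, by omega, by rw [← h0]; congr 1; omega, Or.inr ⟨by omega, rfl⟩⟩
    obtain ⟨i', hi', hci, hii⟩ := hshift hi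
    obtain ⟨j', hj', hcj, hjj⟩ := hshift hj
    have := hc hi' hj' (by rw [← hci, ← hcj, h])
    omega
  have hinj (i j : ℕ) (hi : i < 2 * k) (hj : j < 2 * k) (hij : v i = v j) : i = j := by
    simp only [v] at hij
    split_ifs at hij with h1 h2 h2
    · have := ha (Set.mem_Iio.2 (by omega)) (Set.mem_Iio.2 (by omega)) (inl_injective hij)
      omega
    · have := hc' (by omega) (by omega) (inr_injective hij)
      omega
  refine ⟨⟨⟨fun i => v i, fun {x y} hxy => ?_⟩, fun x y hxy =>
    Fin.ext (hinj _ _ x.2 y.2 hxy)⟩⟩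
  have hsub (x y : Fin (2 * k)) (h : (x - y).val = 1) : G.Adj (v x) (v y) := by
    have hx := x.2
    have hy := y.2
    rcases le_or_gt y x with hle | hlt
    · rw [Fin.sub_val_of_le hle] at h
      rw [show x.val = y.val + 1 by omega]
      exact (hstep _ (by omega)).symm
    · rw [Fin.coe_sub_iff_lt.mpr hlt] at h
      rw [show x.val = 0 by omega, show y.val = 2 * k - 1 by omega]
      exact hlast
  rcases cycleGraph_adj'.1 hxy with h | h
  · exact hsub _ _ h
  · exact (hsub _ _ h).symm

theorem bipCycle_of_hasCycleLen {G : SimpleGraph (α ⊕ β)}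
    (hG : G ≤ completeBipartiteGraph α β) {k : ℕ} (h : HasCycleLen G (2 * k)) :
    BipCycle (fun x y => G.Adj (inl x) (inr y)) k := by
  classical
  obtain ⟨u, w, hw, hlen⟩ := h
  wlog hu : ∃ x, u = inl x generalizing u w
  · obtain ⟨y, rfl⟩ : ∃ y, u = inr y := by
      cases u with
      | inl x => exact absurd ⟨x, rfl⟩ hu
      | inr y => exact ⟨y, rfl⟩
    have hadj := w.adj_snd hw.not_nil
    have hmem : w.snd ∈ w.support := w.getVert_mem_support 1
    refine this w.snd (w.rotate _ hmem) ((Walk.isCycle_rotate hmem).2 hw)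
      (by rwa [Walk.length_rotate]) ?_
    have := hG hadj
    cases hs : w.snd with
    | inl x => exact ⟨x, rfl⟩
    | inr y => simp [hs] at this
  obtain ⟨x, rfl⟩ := hu
  have hadj (i : ℕ) (hi : i < 2 * k) : G.Adj (w.getVert i) (w.getVert (i + 1)) :=
    w.adj_getVert_succ (by omega)
  have hside : ∀ i ≤ k, ∃ a, w.getVert (2 * i) = inl a := by
    intro i hi
    induction i with
    | zero => exact ⟨x, by simp⟩
    | succ i ih =>
      obtain ⟨a, ha⟩ := ih (by omega)
      have h1 := hG (hadj (2 * i) (by omega))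
      have h2 := hG (hadj (2 * i + 1) (by omega))
      rw [ha] at h1
      rw [show 2 * (i + 1) = 2 * i + 1 + 1 by ring]
      rcases hv : w.getVert (2 * i + 1) with z | z <;>
        rcases hv' : w.getVert (2 * i + 1 + 1) with z' | z' <;> simp_all
  have hside' : ∀ i < k, ∃ b, w.getVert (2 * i + 1) = inr b := by
    intro i hi
    obtain ⟨a, ha⟩ := hside i hi.le
    have h1 := hG (hadj (2 * i) (by omega))
    rw [ha] at h1
    rcases hv : w.getVert (2 * i + 1) with z | z <;> simp_all
  have h3 := hw.three_le_length
  have : Nonempty α := ⟨x⟩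
  have : Nonempty β := ⟨(hside' 0 (by omega)).choose⟩
  choose! a ha using hside
  choose! b hb using hside'
  have hinj := hw.getVert_injOn'
  have hlt (i : ℕ) : (i + k - 1) % k < k := Nat.mod_lt _ (by omega)
  have hmod {i : ℕ} (hi : i < k) : (i + k - 1) % k = if i = 0 then k - 1 else i - 1 := by
    split_ifs with h
    · rw [h, Nat.zero_add, Nat.mod_eq_of_lt (by omega)]
    · rw [show i + k - 1 = i - 1 + k by omega, Nat.add_mod_right, Nat.mod_eq_of_lt (by omega)]
  refine ⟨a, fun i => b ((i + k - 1) % k), fun i hi j hj hij => ?_, fun i hi j hj hij => ?_, ?_,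
    fun i hi => ⟨?_, ?_⟩⟩
  · rw [Set.mem_Iio] at hi hj
    have := hinj (x₁ := 2 * i) (x₂ := 2 * j) (by simp; omega) (by simp; omega)
      (by rw [ha _ hi.le, ha _ hj.le, hij])
    omega
  · rw [Set.mem_Iio] at hi hj
    simp only at hij
    have h1 := hlt i
    have h2 := hlt j
    have := hinj (x₁ := 2 * ((i + k - 1) % k) + 1) (x₂ := 2 * ((j + k - 1) % k) + 1)
      (by simp; omega) (by simp; omega) (by rw [hb _ h1, hb _ h2, hij])
    rw [hmod hi, hmod hj] at this
    split_ifs at this <;> omega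
  · simp [show k + k - 1 = k - 1 + k by omega]
  · simp only [hmod hi]
    split_ifs with h
    · subst h
      have := hadj (2 * (k - 1) + 1) (by omega)
      rw [hb _ (by omega), show 2 * (k - 1) + 1 + 1 = w.length by omega, Walk.getVert_length] at this
      have h0 := ha 0 (by omega)
      rw [Nat.mul_zero, Walk.getVert_zero] at h0
      rw [← h0]
      exact this.symm
    · have := hadj (2 * (i - 1) + 1) (by omega)
      rw [hb _ (by omega), show 2 * (i - 1) + 1 + 1 = 2 * i by omega, ha _ hi.le] at this
      exact this.symm
  · have := hadj (2 * i) (by omega)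
    rw [hb _ hi, ha _ hi.le] at this
    simpa [show i + 1 + k - 1 = i + k by omega, Nat.mod_eq_of_lt hi] using this

end Graph

section Lower

theorem not_bipCycle_of_forall_mem {α β : Type*} {R : α → β → Prop} {k : ℕ} (s : Finset α)
    (hs : s.card < k) (h : ∀ x y, R x y → x ∈ s) : ¬ BipCycle R k := by
  rintro ⟨a, c, ha, -, -, hac⟩
  have := Finset.card_le_card_of_injOn (s := Finset.range k) (t := s) a
    (fun i hi => h _ _ (hac i (by simpa using hi)).1) (by simpa using ha)
  rw [Finset.card_range] at this
  omega

/-- A red-blue colouring of `K_{7,7}` without a monochromatic cycle of length `8`. -/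
def sevenTable (x y : Fin 7) : Bool := Nat.testBit 511682092912756 (7 * x.val + y.val)

theorem not_sevenTable_cycle (r : Bool) (a₀ c₁ : Fin 7) : sevenTable a₀ c₁ = r →
    ∀ a₁, a₁ ≠ a₀ → sevenTable a₁ c₁ = r →
    ∀ c₂, c₂ ≠ c₁ → sevenTable a₁ c₂ = r →
    ∀ a₂, a₂ ≠ a₀ → a₂ ≠ a₁ → sevenTable a₂ c₂ = r →
    ∀ c₃, c₃ ≠ c₁ → c₃ ≠ c₂ → sevenTable a₂ c₃ = r →
    ∀ a₃, a₃ ≠ a₀ → a₃ ≠ a₁ → a₃ ≠ a₂ → sevenTable a₃ c₃ = r →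
    ∀ c₀, c₀ ≠ c₁ → c₀ ≠ c₂ → c₀ ≠ c₃ → sevenTable a₃ c₀ = r → sevenTable a₀ c₀ ≠ r := by
  revert r a₀ c₁
  decide +kernel

theorem not_bipCycle_sevenTable (r : Bool) : ¬ BipCycle (fun x y => sevenTable x y = r) 4 := by
  rintro ⟨a, c, ha, hc, h0, hac⟩
  have ha' {i j : ℕ} (h : i < 4 ∧ j < 4 ∧ i ≠ j) : a i ≠ a j :=
    fun hij => h.2.2 (ha h.1 h.2.1 hij)
  have hc' {i j : ℕ} (h : i < 4 ∧ j < 4 ∧ i ≠ j) : c i ≠ c j :=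
    fun hij => h.2.2 (hc h.1 h.2.1 hij)
  have hr (i : ℕ) (hi : i < 4) : sevenTable (a i) (c (i + 1)) = r := (hac i hi).2
  have hl (i : ℕ) (hi : i < 4) : sevenTable (a i) (c i) = r := (hac i hi).1
  have h3 := hr 3 (by decide)
  rw [h0] at h3
  exact not_sevenTable_cycle r (a 0) (c 1) (hr 0 (by decide))
    (a 1) (ha' (by decide)) (hl 1 (by decide))
    (c 2) (hc' (by decide)) (hr 1 (by decide))
    (a 2) (ha' (by decide)) (ha' (by decide)) (hl 2 (by decide))
    (c 3) (hc' (by decide)) (hc' (by decide)) (hr 2 (by decide))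
    (a 3) (ha' (by decide)) (ha' (by decide)) (ha' (by decide)) (hl 3 (by decide))
    (c 0) (hc' (by decide)) (hc' (by decide)) (hc' (by decide)) h3 (hl 0 (by decide))

theorem exists_colouring {n b : ℕ} (hn : 2 ≤ n) (hb : b < if n = 4 then 8 else n + 3) :
    ∃ R : Fin b → Fin b → Prop, ¬ BipCycle R 4 ∧ ¬ BipCycle (fun x y => ¬ R x y) n := by
  by_cases hbn : b ≤ n + 2
  · have hlt : (Finset.univ.filter fun x : Fin b => x.val < 3).card ≤ 3 := by
      rw [← Finset.card_range 3]
      exact Finset.card_le_card_of_injOn (fun x => x.val) (fun x hx => by simpa using hx)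
        Fin.val_injective.injOn
    have hge : (Finset.univ.filter fun x : Fin b => ¬ x.val < 3).card ≤ n - 1 := by
      rw [← Finset.card_range (n - 1)]
      refine Finset.card_le_card_of_injOn (fun x => x.val - 3) (fun x hx => ?_)
        fun x hx y hy hxy => ?_
      · have := x.2
        simp at hx ⊢
        omega
      · simp at hx hy hxy
        omega
    exact ⟨fun x _ => x.val < 3, not_bipCycle_of_forall_mem _ (Nat.lt_succ_of_le hlt) (by simp),
      not_bipCycle_of_forall_mem _ (lt_of_le_of_lt hge (by omega)) (by simp)⟩
  · split_ifs at hb with h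
    · obtain rfl : b = 7 := by omega
      subst h
      exact ⟨fun x y => sevenTable x y = true, not_bipCycle_sevenTable true,
        by simpa using not_bipCycle_sevenTable false⟩
    · omega

/-- The bipartite graph given by a relation. -/
def bipGraph {α β : Type*} (R : α → β → Prop) : SimpleGraph (α ⊕ β) where
  Adj
    | inl x, inr y => R x y
    | inr y, inl x => R x y
    | _, _ => False
  symm := ⟨by rintro (x | x) (y | y) h <;> exact h⟩
  loopless := ⟨by rintro (x | x) h <;> exact h⟩

theorem bipGraph_le {α β : Type*} (R : α → β → Prop) :
    bipGraph R ≤ completeBipartiteGraph α β := by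
  rintro (x | x) (y | y) h <;> simp_all [bipGraph]

end Lower

/-- Main Theorem 1: for `n ≥ 2`, `BR(C_8, C_{2n}) = 8` if `n = 4` and `n + 3`
otherwise. -/
theorem stmt17 (n : ℕ) (hn : 2 ≤ n) :
    IsLeast {b : ℕ | 0 < b ∧ BRprop 8 (2 * n) b}
      (if n = 4 then 8 else n + 3) := by
  refine ⟨⟨by split_ifs <;> omega, fun G _ => ?_⟩, fun b hb => ?_⟩
  · refine (bipCycle_or (R := fun x y => G.Adj (inl x) (inr y)) hn (by simp) (by simp)).imp
      (hasCycleLen_of_bipCycle (k := 4) (by norm_num)) fun h => hasCycleLen_of_bipCycle hn ?_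
    simpa using h
  · by_contra! hlt
    obtain ⟨R, hR, hR'⟩ := exists_colouring hn hlt
    rcases hb.2 (bipGraph R) (bipGraph_le R) with h | h
    · exact hR (bipCycle_of_hasCycleLen (k := 4) (bipGraph_le R) h)
    · refine hR' ?_
      simpa [bipGraph] using bipCycle_of_hasCycleLen sdiff_le h
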